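/- arXiv:1501.04039 — 5 statements merged into one kernel-verified Lean document; each statement's English description precedes it below -/
import Mathlib

section
/- Let 𝒜 be a supersolvable line arrangement in ℙ²(ℝ) with m := m(𝒜) ≥ 3, |𝒜| = 2m, and |Sing₂(𝒜)| = m, and let Q ∈ Sing(𝒜) be a point with m(Q,𝒜) = m (hence modular). Then every line of 𝒜 passing through Q contains at most 2 simple points of 𝒜. -/
open scoped Classical

/-- A point of the projective plane over `K`. -/
abbrev Pt (K : Type*) [Field K] := Projectivization K (Fin 3 → K)

/-- A (candidate) line arrangement: a finite set of linear subspaces of `K³`. -/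
abbrev Arr (K : Type*) [Field K] := Finset (Submodule K (Fin 3 → K))

/-- Every member of `A` is a projective line, i.e. a 2-dimensional linear subspace of `K³`. -/
def IsLineArr {K : Type*} [Field K] (A : Arr K) : Prop :=
  ∀ L ∈ A, Module.finrank K L = 2

/-- The multiplicity `m(P, A)`: the number of lines of `A` passing through `P`. -/
noncomputable def multAt {K : Type*} [Field K] (A : Arr K) (P : Pt K) : ℕ :=
  (A.filter fun L => P.submodule ≤ L).card

/-- `Sing(A)`: the set of points lying on at least two lines of `A`. -/
def SingSet {K : Type*} [Field K] (A : Arr K) : Set (Pt K) :=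
  {P | 2 ≤ multAt A P}

/-- `Sing₂(A)`: the set of simple points, i.e. singular points of multiplicity exactly 2. -/
def Sing2Set {K : Type*} [Field K] (A : Arr K) : Set (Pt K) :=
  {P | multAt A P = 2}

/-- `m(A)`: the maximum multiplicity of a singular point of `A`. -/
noncomputable def maxMult {K : Type*} [Field K] (A : Arr K) : ℕ :=
  sSup (multAt A '' SingSet A)

/-- `P` is a modular point of `A`: it is singular, and for every other singular point `Q`
the line through `P` and `Q` belongs to `A`. -/
def IsModular {K : Type*} [Field K] (A : Arr K) (P : Pt K) : Prop :=
  P ∈ SingSet A ∧ ∀ Q ∈ SingSet A, Q ≠ P → (P.submodule ⊔ Q.submodule) ∈ A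

/-- `A` is supersolvable: it has a modular point. -/
def Supersolvable {K : Type*} [Field K] (A : Arr K) : Prop :=
  ∃ P, IsModular A P

/-- `A` has full rank (rank 3): its lines have no common point. -/
def FullRank {K : Type*} [Field K] (A : Arr K) : Prop :=
  (⨅ L ∈ A, L) = ⊥

open Finset in
/-- A strictly increasing chain in a product of two finite chains of sizes `b` and `b'` has at most
`b + b' - 1` elements. -/
lemma card_add_one_le_of_chain {ι : Type*} {N : Finset ι} (hN : N.Nonempty) (f g : ι → ℝ)
    (hmono : ∀ i ∈ N, ∀ j ∈ N, f i < f j → g i ≤ g j)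
    (hinj : ∀ i ∈ N, ∀ j ∈ N, f i = f j → g i = g j → i = j) :
    N.card + 1 ≤ (N.image f).card + (N.image g).card := by
  let rk (h : ι → ℝ) (i : ι) : ℕ := ((N.image h).filter (· ≤ h i)).card
  have rk_le (h : ι → ℝ) (i j : ι) (hij : h i ≤ h j) : rk h i ≤ rk h j :=
    card_le_card (monotone_filter_right _ fun _ _ hy => le_trans hy hij)
  have rk_lt (h : ι → ℝ) (i j : ι) (hj : j ∈ N) (hij : h i < h j) : rk h i < rk h j := by
    refine card_lt_card ((ssubset_iff_of_subset
      (monotone_filter_right _ fun _ _ hy => le_trans hy hij.le)).2 ⟨h j, ?_, ?_⟩)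
    · exact mem_filter.2 ⟨mem_image_of_mem _ hj, le_rfl⟩
    · simp [hij]
  have rk_pos (h : ι → ℝ) (i : ι) (hi : i ∈ N) : 1 ≤ rk h i :=
    card_pos.2 ⟨h i, mem_filter.2 ⟨mem_image_of_mem _ hi, le_rfl⟩⟩
  have rk_top (h : ι → ℝ) (i : ι) : rk h i ≤ (N.image h).card := card_filter_le _ _
  have hlt : ∀ i ∈ N, ∀ j ∈ N, f i < f j → rk f i + rk g i < rk f j + rk g j :=
    fun i hi j hj hij =>
      add_lt_add_of_lt_of_le (rk_lt f i j hj hij) (rk_le g i j (hmono i hi j hj hij))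
  have key : N.card ≤ (Icc 2 ((N.image f).card + (N.image g).card)).card := by
    refine card_le_card_of_injOn (fun i => rk f i + rk g i) ?_ ?_
    · intro i hi
      have h1 := rk_pos f i hi
      have h2 := rk_pos g i hi
      have h3 := rk_top f i
      have h4 := rk_top g i
      simp only [coe_Icc, Set.mem_Icc]
      omega
    · intro i hi j hj hij
      simp only at hij
      rcases lt_trichotomy (f i) (f j) with h | h | h
      · exact absurd hij (hlt i hi j hj h).ne
      · rcases lt_trichotomy (g i) (g j) with h' | h' | h'
        · have h1 := rk_lt g i j hj h'
          have h2 := rk_le f i j h.le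
          omega
        · exact hinj i hi j hj h h'
        · have h1 := rk_lt g j i hi h'
          have h2 := rk_le f j i h.ge
          omega
      · exact absurd hij (hlt j hj i hi h).ne'
  obtain ⟨i, hi⟩ := hN
  have h1 := rk_pos f i hi
  have h2 := rk_pos g i hi
  have h3 := rk_top f i
  have h4 := rk_top g i
  rw [Nat.card_Icc] at key
  omega

open Finset in
/-- If `f` takes `b` values on `N`, at least `2 b - |N|` of them are taken exactly once. -/
lemma two_mul_card_image_le {ι : Type*} (N : Finset ι) (f : ι → ℝ) :
    2 * (N.image f).card ≤
      N.card + ((N.image f).filter fun y => (N.filter fun i => f i = y).card = 1).card := by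
  rw [card_eq_sum_card_image f N, card_filter, ← sum_add_distrib, mul_comm, ← smul_eq_mul]
  refine card_nsmul_le_sum _ _ _ fun y hy => ?_
  obtain ⟨i, hi, rfl⟩ := mem_image.1 hy
  have : 0 < (N.filter fun j => f j = f i).card := card_pos.2 ⟨i, by simp [hi]⟩
  split_ifs <;> omega

/-- A cyclic sequence whose consecutive terms add up to at least `2` and whose average is at most
`1` has all terms at most `2`. -/
lemma le_two_of_cyclic {n : ℕ} (s : Fin (n + 1) → ℕ) (h : ∀ i, 2 ≤ s i + s (i + 1))
    (hsum : ∑ i, s i ≤ n + 1) (i : Fin (n + 1)) : s i ≤ 2 := by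
  have h1 : ∑ i, s (i + 1) = ∑ i, s i := Equiv.sum_comp (Equiv.addRight (1 : Fin (n + 1))) s
  have h2 : ∑ _i : Fin (n + 1), 2 = ∑ i, (s i + s (i + 1)) := by
    refine le_antisymm (Finset.sum_le_sum fun i _ => h i) ?_
    rw [Finset.sum_add_distrib, h1]
    simp
    omega
  have h3 := (Finset.sum_eq_sum_iff_of_le fun i _ => h i).1 h2 i (Finset.mem_univ i)
  omega

section Planes

variable {K : Type*} [Field K] {L M : Submodule K (Fin 3 → K)}

lemma plane_eq_of_linearIndependent (hL : Module.finrank K L = 2) (hM : Module.finrank K M = 2)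
    {x y : Fin 3 → K} (hxy : LinearIndependent K ![x, y]) (hxL : x ∈ L) (hyL : y ∈ L)
    (hxM : x ∈ M) (hyM : y ∈ M) : L = M := by
  have h2 : Module.finrank K (Submodule.span K (Set.range ![x, y])) = 2 := by
    rw [finrank_span_eq_card hxy, Fintype.card_fin]
  have aux {N : Submodule K (Fin 3 → K)} (hN : Module.finrank K N = 2) (hx : x ∈ N) (hy : y ∈ N) :
      Submodule.span K (Set.range ![x, y]) = N := by
    refine Submodule.eq_of_le_of_finrank_eq (Submodule.span_le.2 ?_) (h2.trans hN.symm)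
    rintro _ ⟨i, rfl⟩
    fin_cases i
    · exact hx
    · exact hy
  exact (aux hL hxL hyL).symm.trans (aux hM hxM hyM)

lemma exists_smul_eq_of_planes_ne (hL : Module.finrank K L = 2) (hM : Module.finrank K M = 2)
    (hne : L ≠ M) {x y : Fin 3 → K} (hx : x ≠ 0) (hxL : x ∈ L) (hyL : y ∈ L)
    (hxM : x ∈ M) (hyM : y ∈ M) : ∃ c : K, c • x = y := by
  by_contra! h
  exact hne (plane_eq_of_linearIndependent hL hM ((LinearIndependent.pair_iff' hx).2 h)
    hxL hyL hxM hyM)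

lemma exists_ne_zero_mem_planes (hL : Module.finrank K L = 2) (hM : Module.finrank K M = 2) :
    ∃ z : Fin 3 → K, z ≠ 0 ∧ z ∈ L ∧ z ∈ M := by
  have h1 := Submodule.finrank_sup_add_finrank_inf_eq L M
  have h2 := Submodule.finrank_le (L ⊔ M)
  rw [Module.finrank_fin_fun] at h2
  have h3 : L ⊓ M ≠ ⊥ := by
    intro h
    rw [h, finrank_bot] at h1
    omega
  obtain ⟨z, hz, hz0⟩ := (Submodule.ne_bot_iff _).1 h3
  exact ⟨z, hz0, hz.1, hz.2⟩

lemma exists_functional_of_plane (hL : Module.finrank K L = 2) {q : Fin 3 → K} (hq : q ∉ L) :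
    ∃ φ : (Fin 3 → K) →ₗ[K] K, φ q = 1 ∧ ∀ v, v ∈ L ↔ φ v = 0 := by
  obtain ⟨ψ, hψ, hle⟩ := Submodule.exists_le_ker_of_notMem hq
  have hker : L = LinearMap.ker ψ := by
    refine Submodule.eq_of_le_of_finrank_le hle ?_
    have h := Submodule.finrank_lt (s := LinearMap.ker ψ)
      (fun h => hψ (LinearMap.mem_ker.1 (h ▸ Submodule.mem_top)))
    rw [Module.finrank_fin_fun] at h
    omega
  refine ⟨(ψ q)⁻¹ • ψ, by simp [hψ], fun v => ?_⟩
  rw [hker]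
  simp [hψ]

/-- Coordinates on the pencil of lines through `[q]` in which no line of `A` is at infinity. -/
lemma exists_frame [Infinite K] {A : Finset (Submodule K (Fin 3 → K))}
    (hA : ∀ L ∈ A, Module.finrank K L = 2) {q : Fin 3 → K} (hne : ∃ L ∈ A, q ∈ L) :
    ∃ e₀ e₁ : Fin 3 → K, (∀ L ∈ A, e₁ ∉ L) ∧ (∀ c : K, c • q ≠ e₁) ∧
      (∀ c d : K, c • q + d • e₁ ≠ e₀) ∧ ∀ L ∈ A, ∃ x : K, e₀ + x • e₁ ∈ L := by
  have htop : (⊤ : Submodule K (Fin 3 → K)) ∉ A := fun h => by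
    have := hA _ h
    rw [finrank_top, Module.finrank_fin_fun] at this
    omega
  obtain ⟨e₁, he₁⟩ := (Set.ne_univ_iff_exists_notMem _).1
    (Subspace.biUnion_ne_univ_of_top_notMem htop)
  simp only [Set.mem_iUnion, SetLike.mem_coe, not_exists] at he₁
  have hspan : Submodule.span K (Set.range ![q, e₁]) ≠ ⊤ := fun h => by
    have := finrank_range_le_card (R := K) ![q, e₁]
    rw [Set.finrank, h, finrank_top, Module.finrank_fin_fun, Fintype.card_fin] at this
    omega
  obtain ⟨e₀, he₀⟩ := SetLike.exists_not_mem_of_ne_top _ hspan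
  refine ⟨e₀, e₁, he₁, ?_, ?_, ?_⟩
  · rintro c rfl
    obtain ⟨L, hL, hqL⟩ := hne
    exact he₁ L hL (L.smul_mem c hqL)
  · rintro c d rfl
    exact he₀ (add_mem (Submodule.smul_mem _ _ (Submodule.subset_span ⟨0, rfl⟩))
      (Submodule.smul_mem _ _ (Submodule.subset_span ⟨1, rfl⟩)))
  · intro L hL
    obtain ⟨ψ, h1, hψ⟩ := exists_functional_of_plane (hA L hL) (he₁ L hL)
    exact ⟨-ψ e₀, by simp [hψ, h1]⟩

open Finset in
/-- In a line arrangement with a modular point `[p]`, a point `[q]` lying on at least as many lines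
as `[p]` is modular too. -/
lemma modular_of_card_le {A : Finset (Submodule K (Fin 3 → K))}
    (hA : ∀ L ∈ A, Module.finrank K L = 2) {p q : Fin 3 → K} (hp0 : p ≠ 0) (hq0 : q ≠ 0)
    (hp : ∀ z ≠ 0, ∀ L ∈ A, ∀ M ∈ A, L ≠ M → z ∈ L → z ∈ M → ∃ N ∈ A, p ∈ N ∧ z ∈ N)
    (hq : ∃ L ∈ A, ∃ M ∈ A, L ≠ M ∧ q ∈ L ∧ q ∈ M)
    (hle : (A.filter fun L => p ∈ L).card ≤ (A.filter fun L => q ∈ L).card) :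
    ∀ z ≠ 0, ∀ L ∈ A, ∀ M ∈ A, L ≠ M → z ∈ L → z ∈ M → ∃ N ∈ A, q ∈ N ∧ z ∈ N := by
  intro z hz L hL M hM hLM hzL hzM
  by_contra! hno
  obtain ⟨N₀, hN₀, hpN₀, hqN₀⟩ : ∃ N ∈ A, p ∈ N ∧ q ∈ N := by
    obtain ⟨L, hL, M, hM, h, hqL, hqM⟩ := hq
    exact hp q hq0 L hL M hM h hqL hqM
  obtain ⟨D, hD, hpD, hzD⟩ : ∃ D ∈ A, p ∉ D ∧ z ∈ D := by
    by_contra! h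
    obtain ⟨c, hc⟩ := exists_smul_eq_of_planes_ne (hA L hL) (hA M hM) hLM hz hzL
      (not_not.1 fun h' => h L hL h' hzL) hzM (not_not.1 fun h' => h M hM h' hzM)
    rcases eq_or_ne c 0 with rfl | hc0
    · exact hp0 (by rw [← hc, zero_smul])
    · exact hno N₀ hN₀ hqN₀ ((N₀.smul_mem_iff hc0).1 (hc ▸ hpN₀))
  have hqD : q ∉ D := fun h => hno D hD h hzD
  obtain ⟨N₁, hN₁, hpN₁, hzN₁⟩ := hp z hz L hL M hM hLM hzL hzM
  have hex : ∀ B : Submodule K (Fin 3 → K), ∃ w : Fin 3 → K, ∃ N : Submodule K (Fin 3 → K),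
      B ∈ A → q ∈ B → w ≠ 0 ∧ w ∈ B ∧ w ∈ D ∧ N ∈ A ∧ p ∈ N ∧ w ∈ N := by
    intro B
    by_cases hB : B ∈ A ∧ q ∈ B
    · obtain ⟨w, hw, hwB, hwD⟩ := exists_ne_zero_mem_planes (hA B hB.1) (hA D hD)
      obtain ⟨N, hN, hpN, hwN⟩ := hp w hw B hB.1 D hD (fun h => hqD (h ▸ hB.2)) hwB hwD
      exact ⟨w, N, fun _ _ => ⟨hw, hwB, hwD, hN, hpN, hwN⟩⟩
    · exact ⟨0, ⊥, fun h h' => absurd ⟨h, h'⟩ hB⟩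
  choose w N hwN using hex
  have hlt : (A.filter fun L => q ∈ L).card ≤ ((A.filter fun L => p ∈ L).erase N₁).card := by
    refine card_le_card_of_injOn N ?_ ?_
    · intro B hB
      obtain ⟨hB, hqB⟩ := mem_filter.1 hB
      obtain ⟨hw, hwB, hwD, hN, hpN, hwN⟩ := hwN B hB hqB
      refine mem_coe.2 (mem_erase.2 ⟨fun h => ?_, mem_filter.2 ⟨hN, hpN⟩⟩)
      obtain ⟨c, hc⟩ := exists_smul_eq_of_planes_ne (hA _ hN) (hA D hD)
        (fun h' => hpD (h' ▸ hpN)) hw hwN (h ▸ hzN₁) hwD hzD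
      exact hno B hB hqB (hc ▸ B.smul_mem c hwB)
    · intro B hB B' hB' h
      obtain ⟨hB, hqB⟩ := mem_filter.1 hB
      obtain ⟨hB', hqB'⟩ := mem_filter.1 hB'
      obtain ⟨hw, hwB, hwD, hN, hpN, hwN₁⟩ := hwN B hB hqB
      obtain ⟨hw', hwB', hwD', hN', hpN', hwN₁'⟩ := hwN B' hB' hqB'
      obtain ⟨c, hc⟩ := exists_smul_eq_of_planes_ne (hA _ hN) (hA D hD)
        (fun h' => hpD (h' ▸ hpN)) hw' (h ▸ hwN₁') hwN₁ hwD' hwD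
      by_contra hne
      obtain ⟨d, hd⟩ := exists_smul_eq_of_planes_ne (hA B hB) (hA B' hB') hne hw hwB hqB
        (hc ▸ B'.smul_mem c hwB') hqB'
      exact hqD (hd ▸ D.smul_mem d hwD)
  rw [card_erase_of_mem (mem_filter.2 ⟨hN₁, hpN₁⟩)] at hlt
  have : 0 < (A.filter fun L => p ∈ L).card := card_pos.2 ⟨N₁, mem_filter.2 ⟨hN₁, hpN₁⟩⟩
  omega

end Planes

lemma submodule_le_iff_rep_mem {K : Type*} [Field K] (P : Pt K) (L : Submodule K (Fin 3 → K)) :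
    P.submodule ≤ L ↔ P.rep ∈ L := by
  rw [Projectivization.submodule_eq, Submodule.span_singleton_le_iff_mem]

/-- Modularity in vector form: every intersection point of two lines of `A` is joined to the modular
point by a line of `A`. -/
lemma IsModular.exists_mem {K : Type*} [Field K] {A : Arr K} {P : Pt K} (hP : IsModular A P) :
    ∀ z ≠ 0, ∀ L ∈ A, ∀ M ∈ A, L ≠ M → z ∈ L → z ∈ M → ∃ N ∈ A, P.rep ∈ N ∧ z ∈ N := by
  intro z hz L hL M hM hLM hzL hzM
  have hmem : Projectivization.mk K z hz ∈ SingSet A := by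
    refine Finset.one_lt_card.2 ⟨L, ?_, M, ?_, hLM⟩ <;>
      simp [Projectivization.submodule_mk, *]
  have hzs : z ∈ (Projectivization.mk K z hz).submodule := by
    rw [Projectivization.submodule_mk]
    exact Submodule.mem_span_singleton_self z
  by_cases h : Projectivization.mk K z hz = P
  · obtain ⟨N, hN⟩ := Finset.card_pos.1 (lt_of_lt_of_le Nat.two_pos hP.1)
    obtain ⟨hNA, hPN⟩ := Finset.mem_filter.1 hN
    exact ⟨N, hNA, (submodule_le_iff_rep_mem P N).1 hPN, hPN (h ▸ hzs)⟩
  · exact ⟨_, hP.2 _ hmem h, (submodule_le_iff_rep_mem P _).1 le_sup_left,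
      (le_sup_right : _ ≤ P.submodule ⊔ _) hzs⟩

lemma multAt_le_maxMult {K : Type*} [Field K] {A : Arr K} {P : Pt K} (hP : P ∈ SingSet A) :
    multAt A P ≤ maxMult A := by
  refine le_csSup ⟨A.card, ?_⟩ ⟨P, hP, rfl⟩
  rintro _ ⟨P, -, rfl⟩
  exact Finset.card_filter_le _ _

lemma multAt_eq_card_filter_rep {K : Type*} [Field K] (A : Arr K) (P : Pt K) :
    multAt A P = (A.filter fun L => P.rep ∈ L).card := by
  simp only [multAt, submodule_le_iff_rep_mem]

open Finset in
/-- If no line through the modular point `[q]` lies strictly between the directions `u` and `v`,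
the lines of `A` not through `[q]` have the same order on both, and meet the two lines of
directions `u` and `v` in many points. -/
lemma card_add_one_le_of_adjacent {A : Arr ℝ} {q : Fin 3 → ℝ}
    (hmod : ∀ z ≠ 0, ∀ L ∈ A, ∀ M ∈ A, L ≠ M → z ∈ L → z ∈ M → ∃ N ∈ A, q ∈ N ∧ z ∈ N)
    (hq : ∃ L ∈ A, q ∈ L) (hne : (A.filter fun L => q ∉ L).Nonempty)
    {φ : Submodule ℝ (Fin 3 → ℝ) → (Fin 3 → ℝ) →ₗ[ℝ] ℝ}
    (hφ : ∀ L ∈ A, q ∉ L → φ L q = 1 ∧ ∀ v, v ∈ L ↔ φ L v = 0) {u v : Fin 3 → ℝ}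
    (hadj : ∀ s > (0 : ℝ), ∀ t > (0 : ℝ), ∀ N ∈ A, q ∈ N → s • u + t • v ∉ N)
    (hinj : ∀ L ∈ A, ∀ M ∈ A, q ∉ L → q ∉ M → φ L u = φ M u → φ L v = φ M v → L = M) :
    (A.filter fun L => q ∉ L).card + 1 ≤ ((A.filter fun L => q ∉ L).image fun L => φ L u).card +
      ((A.filter fun L => q ∉ L).image fun L => φ L v).card := by
  refine card_add_one_le_of_chain hne _ _ ?_ ?_
  · intro L hL M hM hlt
    obtain ⟨hL, hqL⟩ := mem_filter.1 hL
    obtain ⟨hM, hqM⟩ := mem_filter.1 hM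
    by_contra! hgt
    set s := φ L v - φ M v with hs
    set t := φ M u - φ L u with ht
    have hs0 : 0 < s := sub_pos.2 hgt
    have ht0 : 0 < t := sub_pos.2 hlt
    set w := s • u + t • v with hw
    have hw' : φ L w = φ M w := by
      simp only [hw, hs, ht, map_add, map_smul, smul_eq_mul]
      ring
    have hzL : w - φ L w • q ∈ L := by simp [(hφ L hL hqL).2, (hφ L hL hqL).1]
    have hzM : w - φ L w • q ∈ M := by simp [(hφ M hM hqM).2, (hφ M hM hqM).1, hw']
    obtain ⟨N, hN, hqN, hzN⟩ : ∃ N ∈ A, q ∈ N ∧ w - φ L w • q ∈ N := by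
      by_cases hz : w - φ L w • q = 0
      · obtain ⟨N, hN, hqN⟩ := hq
        exact ⟨N, hN, hqN, hz ▸ N.zero_mem⟩
      · exact hmod _ hz L hL M hM (fun h => by simp [h] at hlt) hzL hzM
    exact hadj s hs0 t ht0 N hN hqN ((N.sub_mem_iff_left (N.smul_mem _ hqN)).1 hzN)
  · intro L hL M hM
    obtain ⟨hL, hqL⟩ := mem_filter.1 hL
    obtain ⟨hM, hqM⟩ := mem_filter.1 hM
    exact hinj L hL M hM hqL hqM

open Finset in
/-- The points at which a line `D` through `[q]` meets exactly one line of `A` not through `[q]`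
are simple points of `A`. -/
lemma card_unique_values_le_card_simple {K : Type*} [Field K] {A : Arr K} (hA : IsLineArr A)
    {q : Fin 3 → K} (hq0 : q ≠ 0) {φ : Submodule K (Fin 3 → K) → (Fin 3 → K) →ₗ[K] K}
    (hφ : ∀ L ∈ A, q ∉ L → φ L q = 1 ∧ ∀ v, v ∈ L ↔ φ L v = 0)
    {D : Submodule K (Fin 3 → K)} (hD : D ∈ A) (hqD : q ∈ D) {u : Fin 3 → K} (huD : u ∈ D)
    (hu : ∀ c : K, c • q ≠ u) {F : Finset (Pt K)} (hF : ∀ P, P ∈ F ↔ multAt A P = 2) :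
    (((A.filter fun L => q ∉ L).image fun L => φ L u).filter fun y =>
        ((A.filter fun L => q ∉ L).filter fun L => φ L u = y).card = 1).card ≤
      (F.filter fun P => P.submodule ≤ D).card := by
  have h0 (y : K) : u - y • q ≠ 0 := fun h => hu y (sub_eq_zero.1 h).symm
  refine card_le_card_of_injOn (fun y => Projectivization.mk K (u - y • q) (h0 y)) ?_ ?_
  · intro y hy
    obtain ⟨M, hM⟩ := card_eq_one.1 (mem_filter.1 hy).2
    have hM' (L) : (L ∈ A ∧ q ∉ L) ∧ φ L u = y ↔ L = M := by
      rw [← mem_singleton (a := M), ← hM, mem_filter, mem_filter]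
    obtain ⟨⟨hMA, hqM⟩, hMy⟩ := (hM' M).2 rfl
    have hmult : A.filter (fun L => u - y • q ∈ L) = {D, M} := by
      ext L
      rw [mem_filter, mem_insert, mem_singleton]
      constructor
      · rintro ⟨hL, hz⟩
        by_cases hqL : q ∈ L
        · exact Or.inl (plane_eq_of_linearIndependent (hA L hL) (hA D hD)
            ((LinearIndependent.pair_iff' hq0).2 hu) hqL
            ((L.sub_mem_iff_left (L.smul_mem _ hqL)).1 hz) hqD huD)
        · refine Or.inr ((hM' L).1 ⟨⟨hL, hqL⟩, ?_⟩)
          have := ((hφ L hL hqL).2 _).1 hz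
          simpa [(hφ L hL hqL).1, sub_eq_zero] using this
      · rintro (rfl | rfl)
        · exact ⟨hD, L.sub_mem huD (L.smul_mem _ hqD)⟩
        · exact ⟨hMA, by simp [(hφ L hMA hqM).2, (hφ L hMA hqM).1, hMy]⟩
    refine mem_coe.2 (mem_filter.2 ⟨(hF _).2 ?_, ?_⟩)
    · simp only [multAt, Projectivization.submodule_mk, Submodule.span_singleton_le_iff_mem]
      rw [hmult, card_pair (ne_of_mem_of_not_mem' hqD hqM)]
    · rw [Projectivization.submodule_mk, Submodule.span_singleton_le_iff_mem]
      exact D.sub_mem huD (D.smul_mem _ hqD)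
  · intro y _ y' _ h
    obtain ⟨a, ha⟩ := (Projectivization.mk_eq_mk_iff' K _ _ (h0 y) (h0 y')).1 h
    have h1 : (1 - a) • u = (y - a * y') • q := by
      have : (1 - a) • u - (y - a * y') • q = (u - y • q) - a • (u - y' • q) := by module
      rwa [ha, sub_self, sub_eq_zero] at this
    have ha1 : 1 - a = 0 := by
      by_contra hne
      refine hu ((1 - a)⁻¹ * (y - a * y')) ?_
      rw [mul_smul, ← h1, inv_smul_smul₀ hne]
    have hy : y - a * y' = 0 := by
      rw [ha1, zero_smul] at h1
      exact (smul_eq_zero.1 h1.symm).resolve_right hq0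
    rw [← sub_eq_zero.1 ha1, one_mul] at hy
    exact sub_eq_zero.1 hy

open Finset in
/-- The lines through `[q]` in the cyclic order of their directions `e₀ + x i • e₁`. -/
lemma exists_sorted_pencil {A : Arr ℝ} (hA : IsLineArr A) {q : Fin 3 → ℝ} (hq0 : q ≠ 0)
    {e₀ e₁ : Fin 3 → ℝ} (he₀ : ∀ c d : ℝ, c • q + d • e₁ ≠ e₀)
    (hex : ∀ L ∈ A, q ∈ L → ∃ x : ℝ, e₀ + x • e₁ ∈ L) {m : ℕ}
    (hm : (A.filter fun L => q ∈ L).card = m) :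
    ∃ (D : Fin m → Submodule ℝ (Fin 3 → ℝ)) (x : Fin m → ℝ), StrictMono x ∧
      (∀ i, D i ∈ A ∧ q ∈ D i ∧ e₀ + x i • e₁ ∈ D i) ∧ ∀ L ∈ A, q ∈ L → ∃ i, D i = L := by
  have hex' : ∀ L : Submodule ℝ (Fin 3 → ℝ), ∃ x : ℝ, L ∈ A → q ∈ L → e₀ + x • e₁ ∈ L := by
    intro L
    by_cases hL : L ∈ A ∧ q ∈ L
    · obtain ⟨x, hx⟩ := hex L hL.1 hL.2
      exact ⟨x, fun _ _ => hx⟩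
    · exact ⟨0, fun h h' => absurd ⟨h, h'⟩ hL⟩
  choose X hX using hex'
  have hinj : Set.InjOn X (A.filter fun L => q ∈ L) := by
    intro L hL M hM h
    obtain ⟨hL, hqL⟩ := mem_filter.1 hL
    obtain ⟨hM, hqM⟩ := mem_filter.1 hM
    refine plane_eq_of_linearIndependent (hA L hL) (hA M hM)
      ((LinearIndependent.pair_iff' hq0).2 fun c hc => he₀ c (-X L) ?_)
      hqL (hX L hL hqL) hqM (h ▸ hX M hM hqM)
    rw [hc]
    module
  have hc : ((A.filter fun L => q ∈ L).image X).card = m := by rw [card_image_of_injOn hinj, hm]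
  have hD : ∀ i : Fin m, ∃ L ∈ A.filter fun L => q ∈ L,
      X L = ((A.filter fun L => q ∈ L).image X).orderEmbOfFin hc i := fun i =>
    mem_image.1 (orderEmbOfFin_mem _ hc i)
  choose D hDA hDX using hD
  refine ⟨D, _, (((A.filter fun L => q ∈ L).image X).orderEmbOfFin hc).strictMono, fun i => ?_,
    fun L hL hqL => ?_⟩
  · obtain ⟨h, h'⟩ := mem_filter.1 (hDA i)
    exact ⟨h, h', hDX i ▸ hX _ h h'⟩
  · have hmem : X L ∈ Set.range (((A.filter fun L => q ∈ L).image X).orderEmbOfFin hc) := by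
      rw [range_orderEmbOfFin]
      exact mem_coe.2 (mem_image_of_mem _ (mem_filter.2 ⟨hL, hqL⟩))
    obtain ⟨i, hi⟩ := hmem
    exact ⟨i, hinj (mem_coe.2 (hDA i)) (mem_coe.2 (mem_filter.2 ⟨hL, hqL⟩)) ((hDX i).trans hi)⟩

open Finset in
/-- Two cyclically consecutive lines through the modular point `[q]` meet the lines of `A` not
through `[q]` in many points. -/
lemma card_add_one_le_of_consecutive {A : Arr ℝ} (hA : IsLineArr A) {q : Fin 3 → ℝ}
    (hmod : ∀ z ≠ 0, ∀ L ∈ A, ∀ M ∈ A, L ≠ M → z ∈ L → z ∈ M → ∃ N ∈ A, q ∈ N ∧ z ∈ N)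
    (hne : (A.filter fun L => q ∉ L).Nonempty)
    {φ : Submodule ℝ (Fin 3 → ℝ) → (Fin 3 → ℝ) →ₗ[ℝ] ℝ}
    (hφ : ∀ L ∈ A, q ∉ L → φ L q = 1 ∧ ∀ v, v ∈ L ↔ φ L v = 0)
    {e₀ e₁ : Fin 3 → ℝ} (he₁A : ∀ L ∈ A, q ∈ L → e₁ ∉ L) (he₁ : ∀ c : ℝ, c • q ≠ e₁)
    (he₀ : ∀ c d : ℝ, c • q + d • e₁ ≠ e₀) {n : ℕ} (hn : n ≠ 0)
    {D : Fin (n + 1) → Submodule ℝ (Fin 3 → ℝ)} {x : Fin (n + 1) → ℝ} (hx : StrictMono x)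
    (hD : ∀ i, D i ∈ A ∧ q ∈ D i ∧ e₀ + x i • e₁ ∈ D i)
    (hsurj : ∀ L ∈ A, q ∈ L → ∃ i, D i = L) (i : Fin (n + 1)) :
    (A.filter fun L => q ∉ L).card + 1 ≤
      ((A.filter fun L => q ∉ L).image fun L => φ L (e₀ + x i • e₁)).card +
      ((A.filter fun L => q ∉ L).image fun L => φ L (e₀ + x (i + 1) • e₁)).card := by
  have hq : ∃ L ∈ A, q ∈ L := ⟨D 0, (hD 0).1, (hD 0).2.1⟩
  have hcone {s y : ℝ} {k : Fin (n + 1)} (h : s • e₀ + y • e₁ ∈ D k) : y = s * x k := by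
    obtain ⟨hk, hqk, hek⟩ := hD k
    by_contra hne
    refine he₁A _ hk hqk (((D k).smul_mem_iff (sub_ne_zero.2 hne)).1 ?_)
    convert (D k).sub_mem h ((D k).smul_mem s hek) using 1
    module
  have hinj {x y : ℝ} (hxy : x ≠ y) : ∀ L ∈ A, ∀ M ∈ A, q ∉ L → q ∉ M →
      φ L (e₀ + x • e₁) = φ M (e₀ + x • e₁) → φ L (e₀ + y • e₁) = φ M (e₀ + y • e₁) → L = M := by
    intro L hL M hM hqL hqM h1 h2
    simp only [map_add, map_smul, smul_eq_mul] at h1 h2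
    have h3 : φ L e₁ = φ M e₁ := mul_left_cancel₀ (sub_ne_zero.2 hxy) (by linarith)
    have h4 : φ L e₀ = φ M e₀ := by rw [h3] at h1; linarith
    have hz (v : Fin 3 → ℝ) (hv : φ L v = φ M v) : v - φ L v • q ∈ L ∧ v - φ L v • q ∈ M := by
      simp [(hφ L hL hqL).2, (hφ L hL hqL).1, (hφ M hM hqM).2, (hφ M hM hqM).1, hv]
    have hli : LinearIndependent ℝ ![e₁ - φ L e₁ • q, e₀ - φ L e₀ • q] := by
      refine (LinearIndependent.pair_iff' fun h => he₁ _ (sub_eq_zero.1 h).symm).2 fun a ha =>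
        he₀ (φ L e₀ - a * φ L e₁) a ?_
      rw [← sub_eq_zero, ← sub_eq_zero.2 ha]
      module
    exact plane_eq_of_linearIndependent (hA L hL) (hA M hM) hli (hz e₁ h3).1 (hz e₀ h4).1
      (hz e₁ h3).2 (hz e₀ h4).2
  induction i using Fin.lastCases with
  | cast j =>
    have hlt : x j.castSucc < x j.succ := hx Fin.castSucc_lt_succ
    rw [Fin.coeSucc_eq_succ]
    refine card_add_one_le_of_adjacent hmod hq hne hφ ?_ (hinj hlt.ne)
    intro s hs t ht N hN hqN hmem
    obtain ⟨k, rfl⟩ := hsurj N hN hqN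
    have h := hcone (s := s + t) (y := s * x j.castSucc + t * x j.succ) (k := k)
      (by convert hmem using 1; module)
    rcases le_or_gt k j.castSucc with hk | hk
    · have hk' := hx.monotone hk
      nlinarith
    · have hk' := hx.monotone (Fin.castSucc_lt_iff_succ_le.1 hk)
      nlinarith
  | last =>
    rw [Fin.last_add_one]
    have hlt : x 0 < x (Fin.last n) := hx (Fin.pos_iff_ne_zero.2 (by simpa [Fin.ext_iff] using hn))
    have h := card_add_one_le_of_adjacent hmod hq hne hφ (u := e₀ + x (Fin.last n) • e₁)
      (v := -(e₀ + x 0 • e₁)) ?_ ?_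
    · refine h.trans_eq ?_
      congr 1
      simp only [map_neg]
      rw [← card_image_of_injective _ (neg_injective (G := ℝ)), image_image]
      simp [Function.comp_def]
    · intro s hs t ht N hN hqN hmem
      obtain ⟨k, rfl⟩ := hsurj N hN hqN
      have h := hcone (s := s - t) (y := s * x (Fin.last n) - t * x 0) (k := k)
        (by convert hmem using 1; module)
      have h1 := hx.monotone (Fin.le_last k)
      have h2 := hx.monotone (Fin.zero_le k)
      rcases h1.lt_or_eq with h1 | h1 <;> nlinarith
    · intro L hL M hM hqL hqM h1 h2
      rw [map_neg, map_neg, neg_inj] at h2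
      exact hinj hlt.ne' L hL M hM hqL hqM h1 h2

/-- If `A` is a real supersolvable arrangement with `m := m(A) ≥ 3`,
`|A| = 2m` and `|Sing₂(A)| = m`, and `Q` is a singular point of multiplicity `m`, then every
line of `A` passing through `Q` contains at most 2 simple points of `A`. -/
theorem extremal_lines_through_modular (A : Arr ℝ) (hA : IsLineArr A) (hss : Supersolvable A)
    (hm : 3 ≤ maxMult A) (hcard : A.card = 2 * maxMult A)
    (hs2 : (Sing2Set A).ncard = maxMult A)
    (Q : Pt ℝ) (hQ : Q ∈ SingSet A) (hQmax : multAt A Q = maxMult A) :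
    ∀ L ∈ A, Q.submodule ≤ L → {P ∈ Sing2Set A | P.submodule ≤ L}.ncard ≤ 2 := by
  have hQmem (L : Submodule ℝ (Fin 3 → ℝ)) : Q.submodule ≤ L ↔ Q.rep ∈ L :=
    submodule_le_iff_rep_mem Q L
  obtain ⟨P, hP⟩ := hss
  have hmod := modular_of_card_le hA P.rep_nonzero Q.rep_nonzero hP.exists_mem
    (by
      obtain ⟨L, hL, M, hM, hLM⟩ := Finset.one_lt_card.1 hQ
      rw [Finset.mem_filter, hQmem] at hL hM
      exact ⟨L, hL.1, M, hM.1, hLM, hL.2, hM.2⟩)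
    (by
      rw [← multAt_eq_card_filter_rep, ← multAt_eq_card_filter_rep, hQmax]
      exact multAt_le_maxMult hP.1)
  obtain ⟨n, hn⟩ : ∃ n, maxMult A = n + 1 := ⟨maxMult A - 1, by omega⟩
  have hV : (A.filter fun L => Q.rep ∈ L).card = n + 1 := by
    rw [← multAt_eq_card_filter_rep, hQmax, hn]
  have hN : (A.filter fun L => Q.rep ∉ L).card = n + 1 := by
    have := Finset.card_filter_add_card_filter_not (s := A) fun L => Q.rep ∈ L
    omega
  have hφ : ∀ L : Submodule ℝ (Fin 3 → ℝ), ∃ φ : (Fin 3 → ℝ) →ₗ[ℝ] ℝ,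
      L ∈ A → Q.rep ∉ L → φ Q.rep = 1 ∧ ∀ v, v ∈ L ↔ φ v = 0 := by
    intro L
    by_cases hL : L ∈ A ∧ Q.rep ∉ L
    · obtain ⟨φ, hφ⟩ := exists_functional_of_plane (hA L hL.1) hL.2
      exact ⟨φ, fun _ _ => hφ⟩
    · exact ⟨0, fun h h' => absurd ⟨h, h'⟩ hL⟩
  choose φ hφ using hφ
  have hqL : ∃ L ∈ A, Q.rep ∈ L := by
    obtain ⟨L, hL⟩ := Finset.card_pos.1 (n.succ_pos.trans_eq hV.symm)
    exact ⟨L, Finset.mem_filter.1 hL⟩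
  obtain ⟨e₀, e₁, he₁A, he₁, he₀, hex⟩ := exists_frame hA hqL
  obtain ⟨D, x, hx, hD, hsurj⟩ := exists_sorted_pencil hA Q.rep_nonzero he₀
    (fun L hL _ => hex L hL) hV
  have hfin : (Sing2Set A).Finite := Set.finite_of_ncard_pos (by omega)
  have hF (P : Pt ℝ) : P ∈ hfin.toFinset ↔ multAt A P = 2 := hfin.mem_toFinset
  have hFcard : hfin.toFinset.card = n + 1 := by
    rw [← Set.ncard_eq_toFinset_card _ hfin, hs2, hn]
  let s (i : Fin (n + 1)) : ℕ := (hfin.toFinset.filter fun P => P.submodule ≤ D i).card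
  have hs (i) : 2 * ((A.filter fun L => Q.rep ∉ L).image fun L => φ L (e₀ + x i • e₁)).card ≤
      n + 1 + s i := by
    refine (two_mul_card_image_le _ _).trans (hN ▸ Nat.add_le_add_left ?_ _)
    refine card_unique_values_le_card_simple hA Q.rep_nonzero hφ (hD i).1 (hD i).2.1 (hD i).2.2
      (fun c hc => he₀ c (-x i) ?_) hF
    rw [hc]
    module
  have hpair (i) : 2 ≤ s i + s (i + 1) := by
    have h := card_add_one_le_of_consecutive hA hmod (Finset.card_pos.1 (n.succ_pos.trans_eq hN.symm)) hφ
      (fun L hL _ => he₁A L hL) he₁ he₀ (by omega) hx hD hsurj i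
    have h1 := hs i
    have h2 := hs (i + 1)
    omega
  have hDinj : Function.Injective D := by
    refine fun i j hij => ?_
    by_contra hne
    obtain ⟨hi, -, hei⟩ := hD i
    have hej : e₀ + x j • e₁ ∈ D i := hij ▸ (hD j).2.2
    refine he₁A _ hi (((D i).smul_mem_iff (sub_ne_zero.2 (hx.injective.ne hne))).1 ?_)
    convert (D i).sub_mem hei hej using 1
    module
  have hsum : ∑ i, s i ≤ n + 1 := by
    refine (Finset.card_biUnion ?_).symm.trans_le (le_trans (Finset.card_le_card
      (Finset.biUnion_subset.2 fun i _ => Finset.filter_subset _ _)) hFcard.le)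
    · intro i _ j _ hij
      refine Finset.disjoint_left.2 fun P hPi hPj => ?_
      obtain ⟨hPF, hPi⟩ := Finset.mem_filter.1 hPi
      obtain ⟨-, hPj⟩ := Finset.mem_filter.1 hPj
      rw [submodule_le_iff_rep_mem] at hPi hPj
      obtain ⟨c, hc⟩ := exists_smul_eq_of_planes_ne (hA _ (hD i).1) (hA _ (hD j).1)
        (hDinj.ne hij) Q.rep_nonzero (hD i).2.1 hPi (hD j).2.1 hPj
      have hc0 : c ≠ 0 := by
        rintro rfl
        exact P.rep_nonzero (by rw [← hc, zero_smul])
      have h2 := (hF P).1 hPF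
      simp only [multAt_eq_card_filter_rep, ← hc, Submodule.smul_mem_iff _ hc0] at h2
      omega
  intro L hL hqL
  obtain ⟨i, rfl⟩ := hsurj L hL ((hQmem L).1 hqL)
  refine le_of_eq_of_le ?_ (le_two_of_cyclic s hpair hsum i)
  rw [show s i = _ from (Set.ncard_coe_finset _).symm]
  congr 1
  ext P
  simp [hfin.mem_toFinset]
end

section
/- Let Q_{12}, Q_{13}, Q_{23} be three non-collinear points of the real projective plane ℙ²(ℝ), forming a triangle with sides M₁ (the line through Q_{12} and Q_{13}), M₂ (the line through Q_{12} and Q_{23}), and M₃ (the line through Q_{13} and Q_{23}). Let Q be a point not lying on any of the lines M₁, M₂, M₃, and define Q₁ as the intersection of the line through Q and Q_{23} with M₁, Q₂ as the intersection of the line through Q and Q_{13} with M₂, and Q₃ as the intersection of the line through Q and Q_{12} with M₃. Then Q₁, Q₂, Q₃ are not collinear. -/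
open scoped Classical

/-- A submodule containing a nonzero vector of a projective point contains the point. -/
lemma Projectivization.submodule_le_of_mem {K V : Type*} [Field K] [AddCommGroup V] [Module K V]
    (P : Projectivization K V) {S : Submodule K V} {x : V} (hx : x ∈ P.submodule) (hx0 : x ≠ 0)
    (hxS : x ∈ S) : P.submodule ≤ S := by
  rw [P.submodule_eq] at hx ⊢
  obtain ⟨a, rfl⟩ := Submodule.mem_span_singleton.mp hx
  have ha : a ≠ 0 := fun h => hx0 (by simp [h])
  exact (Submodule.span_singleton_le_iff_mem _ _).mpr ((S.smul_mem_iff ha).mp hxS)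

/-- If a submodule over a field of characteristic not two contains the pairwise sums of three
vectors, then it contains the first of them. -/
lemma Submodule.mem_of_pairwise_add_mem {K V : Type*} [Field K] [NeZero (2 : K)] [AddCommGroup V]
    [Module K V] {S : Submodule K V} {x y z : V} (hxy : x + y ∈ S) (hxz : x + z ∈ S)
    (hyz : y + z ∈ S) : x ∈ S := by
  refine (S.smul_mem_iff (two_ne_zero (α := K))).mp ?_
  have h := S.sub_mem (S.add_mem hxy hxz) hyz
  rwa [show x + y + (x + z) - (y + z) = (2 : K) • x by rw [two_smul]; abel] at h

/-- Let `Q₁₂, Q₁₃, Q₂₃` be three non-collinear points of `ℙ²(ℝ)` with triangle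
sides `M₁ = Q₁₂Q₁₃`, `M₂ = Q₁₂Q₂₃`, `M₃ = Q₁₃Q₂₃`, and let `Q` be a point on none of these
lines. If `Q₁ = QQ₂₃ ∩ M₁`, `Q₂ = QQ₁₃ ∩ M₂`, `Q₃ = QQ₁₂ ∩ M₃`, then `Q₁, Q₂, Q₃` are not
collinear. -/
theorem cevian_points_not_collinear (Q12 Q13 Q23 Q Q1 Q2 Q3 : Pt ℝ)
    (hnc : Q12.submodule ⊔ Q13.submodule ⊔ Q23.submodule = ⊤)
    (hQM1 : ¬ Q.submodule ≤ Q12.submodule ⊔ Q13.submodule)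
    (hQM2 : ¬ Q.submodule ≤ Q12.submodule ⊔ Q23.submodule)
    (hQM3 : ¬ Q.submodule ≤ Q13.submodule ⊔ Q23.submodule)
    (hQ1 : Q1.submodule = (Q.submodule ⊔ Q23.submodule) ⊓ (Q12.submodule ⊔ Q13.submodule))
    (hQ2 : Q2.submodule = (Q.submodule ⊔ Q13.submodule) ⊓ (Q12.submodule ⊔ Q23.submodule))
    (hQ3 : Q3.submodule = (Q.submodule ⊔ Q12.submodule) ⊓ (Q13.submodule ⊔ Q23.submodule)) :
    Q1.submodule ⊔ Q2.submodule ⊔ Q3.submodule = ⊤ := by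
  obtain ⟨q, hq, hq0⟩ := Q.submodule.ne_bot_iff.mp (fun h => hQM1 (h ▸ bot_le))
  obtain ⟨_, hxy, z, hz, hsum⟩ := Submodule.mem_sup.mp (hnc ▸ Submodule.mem_top : q ∈ _)
  obtain ⟨x, hx, y, hy, rfl⟩ := Submodule.mem_sup.mp hxy
  have hx0 : x ≠ 0 := by
    rintro rfl
    refine hQM3 (Q.submodule_le_of_mem hq hq0 ?_)
    rw [← hsum, zero_add]
    exact Submodule.add_mem_sup hy hz
  have hy0 : y ≠ 0 := by
    rintro rfl
    refine hQM2 (Q.submodule_le_of_mem hq hq0 ?_)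
    rw [← hsum, add_zero]
    exact Submodule.add_mem_sup hx hz
  have hz0 : z ≠ 0 := by
    rintro rfl
    refine hQM1 (Q.submodule_le_of_mem hq hq0 ?_)
    rwa [← hsum, add_zero]
  have h1 : x + y ∈ Q1.submodule := by
    rw [hQ1]
    refine ⟨?_, hxy⟩
    rw [show x + y = q + -z by rw [← hsum]; abel]
    exact Submodule.add_mem_sup hq (neg_mem hz)
  have h2 : x + z ∈ Q2.submodule := by
    rw [hQ2]
    refine ⟨?_, Submodule.add_mem_sup hx hz⟩
    rw [show x + z = q + -y by rw [← hsum]; abel]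
    exact Submodule.add_mem_sup hq (neg_mem hy)
  have h3 : y + z ∈ Q3.submodule := by
    rw [hQ3]
    refine ⟨?_, Submodule.add_mem_sup hy hz⟩
    rw [show y + z = q + -x by rw [← hsum]; abel]
    exact Submodule.add_mem_sup hq (neg_mem hx)
  replace h1 := Submodule.mem_sup_left (T := Q3.submodule)
    (Submodule.mem_sup_left (T := Q2.submodule) h1)
  replace h2 := Submodule.mem_sup_left (T := Q3.submodule)
    (Submodule.mem_sup_right (S := Q1.submodule) h2)
  replace h3 := Submodule.mem_sup_right (S := Q1.submodule ⊔ Q2.submodule) h3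
  rw [eq_top_iff, ← hnc]
  refine sup_le (sup_le ?_ ?_) ?_
  · exact Q12.submodule_le_of_mem hx hx0 (Submodule.mem_of_pairwise_add_mem h1 h2 h3)
  · exact Q13.submodule_le_of_mem hy hy0
      (Submodule.mem_of_pairwise_add_mem (add_comm x y ▸ h1) h3 h2)
  · exact Q23.submodule_le_of_mem hz hz0
      (Submodule.mem_of_pairwise_add_mem (add_comm x z ▸ h2) (add_comm y z ▸ h3) h1)
end

section
/- Let 𝒜 be a supersolvable line arrangement in ℙ² over an arbitrary field having two modular points Q₁ and Q₂ with distinct multiplicities m(Q₁,𝒜) ≠ m(Q₂,𝒜). Then every line of 𝒜 passes through Q₁ or through Q₂, and m(Q₁,𝒜) + m(Q₂,𝒜) = |𝒜| + 1. -/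
open scoped Classical

theorem finrank_inf_of_finrank_eq_two {K : Type*} [Field K] {L M : Submodule K (Fin 3 → K)}
    (hL : Module.finrank K L = 2) (hM : Module.finrank K M = 2) (hne : L ≠ M) :
    Module.finrank K ↥(L ⊓ M) = 1 := by
  have hadd := Submodule.finrank_sup_add_finrank_inf_eq L M
  have htop : Module.finrank K ↥(L ⊔ M) ≤ 3 := by
    simpa using Submodule.finrank_le (L ⊔ M)
  have hlt : L < L ⊔ M := by
    refine lt_of_le_of_ne le_sup_left fun h => hne ?_
    have hML : M ≤ L := by rw [h]; exact le_sup_right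
    exact (Submodule.eq_of_le_of_finrank_eq hML (by omega)).symm
  have := Submodule.finrank_lt_finrank_of_lt hlt
  omega

theorem exists_point_eq_inf {K : Type*} [Field K] {L M : Submodule K (Fin 3 → K)}
    (hL : Module.finrank K L = 2) (hM : Module.finrank K M = 2) (hne : L ≠ M) :
    ∃ R : Pt K, R.submodule = L ⊓ M :=
  ⟨Projectivization.mk'' _ (finrank_inf_of_finrank_eq_two hL hM hne),
    Projectivization.submodule_mk'' _ _⟩

theorem sup_submodule_eq_line {K : Type*} [Field K] {P Q : Pt K}
    {L : Submodule K (Fin 3 → K)} (hL : Module.finrank K L = 2) (hne : P ≠ Q)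
    (hP : P.submodule ≤ L) (hQ : Q.submodule ≤ L) : P.submodule ⊔ Q.submodule = L := by
  have hle : P.submodule ⊔ Q.submodule ≤ L := sup_le hP hQ
  refine Submodule.eq_of_le_of_finrank_le hle ?_
  have hlt : P.submodule < P.submodule ⊔ Q.submodule := by
    refine lt_of_le_of_ne le_sup_left fun h => hne (Projectivization.submodule_injective ?_)
    have hQP : Q.submodule ≤ P.submodule := by rw [h]; exact le_sup_right
    exact (Submodule.eq_of_le_of_finrank_eq hQP (by simp [Projectivization.finrank_submodule])).symm
  have := Submodule.finrank_lt_finrank_of_lt hlt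
  rw [Projectivization.finrank_submodule] at this
  omega

theorem mem_singSet_of_le {K : Type*} [Field K] {A : Arr K} {L M : Submodule K (Fin 3 → K)}
    {R : Pt K} (hL : L ∈ A) (hM : M ∈ A) (hne : L ≠ M) (hRL : R.submodule ≤ L)
    (hRM : R.submodule ≤ M) : R ∈ SingSet A :=
  Finset.one_lt_card.2
    ⟨L, Finset.mem_filter.2 ⟨hL, hRL⟩, M, Finset.mem_filter.2 ⟨hM, hRM⟩, hne⟩

/-- Projecting from a line through neither point compares the pencils of two points of an
arrangement, provided the target point is modular. -/
theorem multAt_le_of_isModular {K : Type*} [Field K] {A : Arr K} (hA : IsLineArr A)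
    {P Q : Pt K} (hQ : IsModular A Q) {L : Submodule K (Fin 3 → K)} (hL : L ∈ A)
    (hPL : ¬ P.submodule ≤ L) (hQL : ¬ Q.submodule ≤ L) : multAt A P ≤ multAt A Q := by
  have key : ∀ M ∈ A, P.submodule ≤ M → Q.submodule ⊔ (M ⊓ L) ∈ A ∧
      (Q.submodule ⊔ (M ⊓ L)) ⊓ L = M ⊓ L ∧ P.submodule ⊔ (M ⊓ L) = M := by
    intro M hM hPM
    have hne : M ≠ L := by rintro rfl; exact hPL hPM
    obtain ⟨R, hR⟩ := exists_point_eq_inf (hA M hM) (hA L hL) hne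
    have hRM : R.submodule ≤ M := hR.trans_le inf_le_left
    have hRL : R.submodule ≤ L := hR.trans_le inf_le_right
    have hRQ : R ≠ Q := by rintro rfl; exact hQL hRL
    have hPR : P ≠ R := by rintro rfl; exact hPL hRL
    rw [← hR]
    have hN := hQ.2 R (mem_singSet_of_le hM hL hne hRM hRL) hRQ
    refine ⟨hN, ?_, sup_submodule_eq_line (hA M hM) hPR hPM hRM⟩
    have hNL : Q.submodule ⊔ R.submodule ≠ L := fun h => hQL (le_sup_left.trans_eq h)
    refine (Submodule.eq_of_le_of_finrank_eq (le_inf le_sup_right hRL) ?_).symm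
    rw [finrank_inf_of_finrank_eq_two (hA _ hN) (hA L hL) hNL,
      Projectivization.finrank_submodule]
  refine Finset.card_le_card_of_injOn (fun M => Q.submodule ⊔ (M ⊓ L)) ?_ ?_
  · intro M hM
    obtain ⟨hM, hPM⟩ := Finset.mem_filter.1 hM
    exact Finset.mem_filter.2 ⟨(key M hM hPM).1, le_sup_left⟩
  · intro M hM N hN h
    obtain ⟨hM, hPM⟩ := Finset.mem_filter.1 hM
    obtain ⟨hN, hPN⟩ := Finset.mem_filter.1 hN
    obtain ⟨-, hM1, hM2⟩ := key M hM hPM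
    obtain ⟨-, hN1, hN2⟩ := key N hN hPN
    have hMN : M ⊓ L = N ⊓ L := by
      rw [← hM1, ← hN1]
      exact congrArg (· ⊓ L) h
    rw [← hM2, ← hN2, hMN]

/-- If a supersolvable line arrangement has two modular points `Q₁, Q₂`
of distinct multiplicities, then every line of `A` passes through `Q₁` or `Q₂`, and
`m(Q₁, A) + m(Q₂, A) = |A| + 1`. -/
theorem two_modular_points {K : Type*} [Field K] (A : Arr K) (hA : IsLineArr A)
    (Q1 Q2 : Pt K) (h1 : IsModular A Q1) (h2 : IsModular A Q2)
    (hne : multAt A Q1 ≠ multAt A Q2) :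
    (∀ L ∈ A, Q1.submodule ≤ L ∨ Q2.submodule ≤ L) ∧
    multAt A Q1 + multAt A Q2 = A.card + 1 := by
  have hQ : Q1 ≠ Q2 := by rintro rfl; exact hne rfl
  have hcover : ∀ L ∈ A, Q1.submodule ≤ L ∨ Q2.submodule ≤ L := by
    intro L hL
    by_contra! h
    exact hne (le_antisymm (multAt_le_of_isModular hA h2 hL h.1 h.2)
      (multAt_le_of_isModular hA h1 hL h.2 h.1))
  refine ⟨hcover, ?_⟩
  have hunion : (A.filter fun L => Q1.submodule ≤ L) ∪ (A.filter fun L => Q2.submodule ≤ L)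
      = A := by
    rw [← Finset.filter_or]
    exact Finset.filter_true_of_mem hcover
  have hinter : (A.filter fun L => Q1.submodule ≤ L) ∩ (A.filter fun L => Q2.submodule ≤ L)
      = {Q1.submodule ⊔ Q2.submodule} := by
    ext L
    simp only [Finset.mem_inter, Finset.mem_filter, Finset.mem_singleton]
    constructor
    · rintro ⟨⟨hL, hL1⟩, -, hL2⟩
      exact (sup_submodule_eq_line (hA L hL) hQ hL1 hL2).symm
    · rintro rfl
      have hmem := h1.2 Q2 h2.1 hQ.symm
      exact ⟨⟨hmem, le_sup_left⟩, hmem, le_sup_right⟩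
  have hcard := Finset.card_union_add_card_inter
    (A.filter fun L => Q1.submodule ≤ L) (A.filter fun L => Q2.submodule ≤ L)
  rw [hunion, hinter, Finset.card_singleton] at hcard
  exact hcard.symm
end

section
/- Let K be a field of characteristic 0 and let 𝒜 be a full rank supersolvable arrangement of n lines in ℙ²(K) with maximum multiplicity m := m(𝒜) ≥ 3. Then |Sing₂(𝒜)| ≥ 2·|Sing(𝒜)| − m(n − m) − 2. -/
open scoped Classical

section Incidence

variable {α β : Type*} {I : α → β → Prop} {A : Finset β}

/-- A point lying on two lines of `A` lies on a line of `A` avoiding any other given point. -/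
theorem exists_line_avoiding
    (huniq : ∀ L ∈ A, ∀ M ∈ A, ∀ P Q, P ≠ Q → I P L → I Q L → I P M → I Q M → L = M)
    {P Q : α} (hPQ : Q ≠ P) (hQ : 2 ≤ (A.filter (I Q)).card) :
    ∃ L ∈ A, I Q L ∧ ¬ I P L := by
  obtain ⟨L, hL, M, hM, hne⟩ := Finset.one_lt_card.1 hQ
  rw [Finset.mem_filter] at hL hM
  by_contra! h
  exact hne (huniq L hL.1 M hM.1 Q P hPQ hL.2 (h L hL.1 hL.2) hM.2 (h M hM.1 hM.2))

/-- The points on at least two lines of `A` are finite in number. -/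
theorem finite_setOf_two_le_card
    (huniq : ∀ L ∈ A, ∀ M ∈ A, ∀ P Q, P ≠ Q → I P L → I Q L → I P M → I Q M → L = M) :
    {Q | 2 ≤ (A.filter (I Q)).card}.Finite := by
  refine Set.Finite.of_injOn (f := fun Q => A.filter (I Q)) (t := (A.powerset : Set (Finset β)))
    (fun Q _ => Finset.mem_coe.2 (Finset.mem_powerset.2 (Finset.filter_subset _ _))) ?_
    (Finset.finite_toSet _)
  intro Q hQ R _ hQR
  by_contra hne
  obtain ⟨L, hL, hQL, hRL⟩ := exists_line_avoiding huniq hne hQ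
  have hmem : L ∈ A.filter (I Q) := Finset.mem_filter.2 ⟨hL, hQL⟩
  exact hRL (Finset.mem_filter.1 ((congrArg (L ∈ ·) hQR).mp hmem)).2

/-- A singular point whose multiplicity is at least that of a modular point is modular. -/
theorem modular_of_card_le_s15
    (huniq : ∀ L ∈ A, ∀ M ∈ A, ∀ P Q, P ≠ Q → I P L → I Q L → I P M → I Q M → L = M)
    (hmeet : ∀ L ∈ A, ∀ M ∈ A, L ≠ M → ∃ P, I P L ∧ I P M)
    {P R : α}
    (hP : ∀ Q, 2 ≤ (A.filter (I Q)).card → Q ≠ P → ∃ L ∈ A, I P L ∧ I Q L)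
    (hR : 2 ≤ (A.filter (I R)).card)
    (hPR : (A.filter (I P)).card ≤ (A.filter (I R)).card) :
    ∀ Q, 2 ≤ (A.filter (I Q)).card → Q ≠ R → ∃ L ∈ A, I R L ∧ I Q L := by
  intro Q hQ hQR
  rcases eq_or_ne R P with rfl | hRP
  · exact hP Q hQ hQR
  rcases eq_or_ne Q P with rfl | hQP
  · obtain ⟨L, hL, h1, h2⟩ := hP R hR hRP
    exact ⟨L, hL, h2, h1⟩
  by_contra! hno
  obtain ⟨l, hl, hQl, hPl⟩ := exists_line_avoiding huniq hQP hQ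
  have hRl : ¬ I R l := fun h => hno l hl h hQl
  obtain ⟨N₀, hN₀, hPN₀, hQN₀⟩ := hP Q hQ hQP
  have key : ∀ M ∈ A.filter (I R), ∃ N, N ∈ A ∧ I P N ∧ ∃ X, I X M ∧ I X l ∧ I X N := by
    intro M hM
    rw [Finset.mem_filter] at hM
    have hMl : M ≠ l := by rintro rfl; exact hRl hM.2
    obtain ⟨X, hXM, hXl⟩ := hmeet M hM.1 l hl hMl
    have hXP : X ≠ P := by rintro rfl; exact hPl hXl
    have hX : 2 ≤ (A.filter (I X)).card := Finset.one_lt_card.2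
      ⟨M, Finset.mem_filter.2 ⟨hM.1, hXM⟩, l, Finset.mem_filter.2 ⟨hl, hXl⟩, hMl⟩
    obtain ⟨N, hN, hPN, hXN⟩ := hP X hX hXP
    exact ⟨N, hN, hPN, X, hXM, hXl, hXN⟩
  -- two points of `l` on the same line through `P` coincide
  have hcoinc : ∀ N ∈ A, I P N → ∀ X Y, I X l → I Y l → I X N → I Y N → X = Y := by
    intro N hN hPN X Y hX hY hXN hYN
    by_contra hne
    exact hPl (huniq l hl N hN X Y hne hX hY hXN hYN ▸ hPN)
  have : Nonempty α := ⟨P⟩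
  have : Nonempty β := ⟨l⟩
  choose! f hfA hfP X hXM hXl hXN using key
  have hcard : (A.filter (I R)).card ≤ ((A.filter (I P)).erase N₀).card := by
    refine Finset.card_le_card_of_injOn f (fun M hM => ?_) (fun M hM M' hM' hff => ?_)
    · have hM₁ := Finset.mem_coe.1 hM
      refine Finset.mem_coe.2 (Finset.mem_erase.2 ⟨fun h => ?_,
        Finset.mem_filter.2 ⟨hfA M hM₁, hfP M hM₁⟩⟩)
      have hXQ : X M = Q :=
        hcoinc N₀ hN₀ hPN₀ _ _ (hXl M hM₁) hQl (h ▸ hXN M hM₁) hQN₀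
      rw [Finset.mem_filter] at hM₁
      exact hno M hM₁.1 hM₁.2 (hXQ ▸ hXM M hM)
    · have hM₁ := Finset.mem_coe.1 hM
      have hM₂ := Finset.mem_coe.1 hM'
      have hXX : X M = X M' := hcoinc (f M) (hfA M hM₁) (hfP M hM₁) _ _ (hXl M hM₁)
        (hXl M' hM₂) (hXN M hM₁) (hff ▸ hXN M' hM₂)
      have hXR : X M ≠ R := fun h => hRl (h ▸ hXl M hM₁)
      have h1 := hXM M hM₁
      have h2 := hXX ▸ hXM M' hM₂
      rw [Finset.mem_filter] at hM₁ hM₂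
      exact huniq M hM₁.1 M' hM₂.1 (X M) R hXR h1 hM₁.2 h2 hM₂.2
  have hlt := Finset.card_erase_lt_of_mem (Finset.mem_filter.2 ⟨hN₀, hPN₀⟩ : N₀ ∈ A.filter (I P))
  omega

/-- Counting incidences with the lines that avoid a modular point `P`. -/
theorem sum_card_le_of_modular
    (huniq : ∀ L ∈ A, ∀ M ∈ A, ∀ P Q, P ≠ Q → I P L → I Q L → I P M → I Q M → L = M)
    {P : α} {S : Finset α} (hPS : P ∉ S) (hS : ∀ Q ∈ S, ∃ L ∈ A, I P L ∧ I Q L) :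
    ∑ Q ∈ S, (A.filter (I Q)).card ≤
      S.card + (A.filter (I P)).card * (A.filter (¬ I P ·)).card := by
  set B := A.filter (¬ I P ·) with hB
  have hne : ∀ Q ∈ S, Q ≠ P := fun Q hQ h => hPS (h ▸ hQ)
  have h₁ : ∀ Q ∈ S, (A.filter (I Q)).card ≤ 1 + (B.filter (I Q)).card := by
    intro Q hQ
    obtain ⟨N, hN, hPN, hQN⟩ := hS Q hQ
    have hsub : A.filter (I Q) ⊆ insert N (B.filter (I Q)) := by
      intro L hL
      rw [Finset.mem_filter] at hL
      by_cases hPL : I P L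
      · rw [huniq L hL.1 N hN Q P (hne Q hQ) hL.2 hPL hQN hPN]
        exact Finset.mem_insert_self _ _
      · simp [hB, hL, hPL]
    have := (Finset.card_le_card hsub).trans (Finset.card_insert_le _ _)
    omega
  have h₂ : ∀ L ∈ B, (S.filter (I · L)).card ≤ (A.filter (I P)).card := by
    intro L hL
    rw [hB, Finset.mem_filter] at hL
    have : Nonempty β := ⟨L⟩
    choose! g hgA hgP hgQ using hS
    refine Finset.card_le_card_of_injOn g (fun Q hQ => ?_) (fun Q hQ R hR hQR => ?_)
    · have hQ := (Finset.mem_filter.1 (Finset.mem_coe.1 hQ)).1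
      exact Finset.mem_coe.2 (Finset.mem_filter.2 ⟨hgA Q hQ, hgP Q hQ⟩)
    · rw [Finset.mem_coe, Finset.mem_filter] at hQ hR
      by_contra h
      exact hL.2 (huniq L hL.1 (g Q) (hgA Q hQ.1) Q R h hQ.2 hR.2 (hgQ Q hQ.1)
        (hQR ▸ hgQ R hR.1) ▸ hgP Q hQ.1)
  calc ∑ Q ∈ S, (A.filter (I Q)).card
      ≤ ∑ Q ∈ S, (1 + (B.filter (I Q)).card) := Finset.sum_le_sum h₁
    _ = S.card + ∑ Q ∈ S, (B.filter (I Q)).card := by simp [Finset.sum_add_distrib]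
    _ = S.card + ∑ L ∈ B, (S.filter (I · L)).card := by
      congr 1
      exact Finset.sum_card_bipartiteAbove_eq_sum_card_bipartiteBelow I
    _ ≤ S.card + ∑ L ∈ B, (A.filter (I P)).card := by gcongr with L hL; exact h₂ L hL
    _ = _ := by simp [mul_comm]

end Incidence

section Projective

variable {K : Type*} [Field K]

theorem finrank_sup_submodule {P Q : Pt K} (h : P ≠ Q) :
    Module.finrank K ↥(P.submodule ⊔ Q.submodule) = 2 := by
  have hinf : P.submodule ⊓ Q.submodule = ⊥ := by
    by_contra hb
    have h0 : 0 < Module.finrank K ↥(P.submodule ⊓ Q.submodule) :=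
      Nat.pos_of_ne_zero fun h => hb (Submodule.finrank_eq_zero.1 h)
    have h1 := Submodule.eq_of_le_of_finrank_le (inf_le_left : P.submodule ⊓ Q.submodule ≤ _)
      (by rw [P.finrank_submodule]; exact h0)
    have h2 := Submodule.eq_of_le_of_finrank_le (inf_le_right : P.submodule ⊓ Q.submodule ≤ _)
      (by rw [Q.finrank_submodule]; exact h0)
    exact h (Projectivization.submodule_injective (h1.symm.trans h2))
  have := Submodule.finrank_sup_add_finrank_inf_eq P.submodule Q.submodule
  rw [hinf, P.finrank_submodule, Q.finrank_submodule, finrank_bot] at this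
  exact this

theorem eq_sup_of_finrank_eq_two {P Q : Pt K} (h : P ≠ Q) {L : Submodule K (Fin 3 → K)}
    (hL : Module.finrank K L = 2) (hPL : P.submodule ≤ L) (hQL : Q.submodule ≤ L) :
    P.submodule ⊔ Q.submodule = L :=
  Submodule.eq_of_le_of_finrank_le (sup_le hPL hQL) (by rw [hL, finrank_sup_submodule h])

theorem exists_point_of_finrank_eq_two {L M : Submodule K (Fin 3 → K)}
    (hL : Module.finrank K L = 2) (hM : Module.finrank K M = 2) :
    ∃ P : Pt K, P.submodule ≤ L ∧ P.submodule ≤ M := by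
  have h1 := Submodule.finrank_sup_add_finrank_inf_eq L M
  have h2 := Submodule.finrank_le (L ⊔ M)
  rw [Module.finrank_fin_fun] at h2
  have h3 : L ⊓ M ≠ ⊥ := by
    intro h
    rw [h, finrank_bot] at h1
    omega
  obtain ⟨v, hv, hv0⟩ := Submodule.exists_mem_ne_zero_of_ne_bot h3
  refine ⟨Projectivization.mk K v hv0, ?_, ?_⟩ <;>
    rw [Projectivization.submodule_mk, Submodule.span_singleton_le_iff_mem]
  exacts [hv.1, hv.2]

end Projective

/-- Over a field of characteristic 0, a full rank supersolvable arrangement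
of `n` lines with maximum multiplicity `m := m(A) ≥ 3` satisfies
`|Sing₂(A)| ≥ 2·|Sing(A)| − m(n − m) − 2`. -/
theorem sing2_lower_bound {K : Type*} [Field K] [CharZero K] (A : Arr K)
    (hA : IsLineArr A) (hfr : FullRank A) (hss : Supersolvable A) (hm : 3 ≤ maxMult A) :
    2 * ((SingSet A).ncard : ℤ) - (maxMult A : ℤ) * ((A.card : ℤ) - (maxMult A : ℤ)) - 2 ≤
      ((Sing2Set A).ncard : ℤ) := by
  let I : Pt K → Submodule K (Fin 3 → K) → Prop := fun P L => P.submodule ≤ L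
  have huniq : ∀ L ∈ A, ∀ M ∈ A, ∀ P Q, P ≠ Q → I P L → I Q L → I P M → I Q M → L = M :=
    fun L hL M hM P Q h h1 h2 h3 h4 => (eq_sup_of_finrank_eq_two h (hA L hL) h1 h2).symm.trans
      (eq_sup_of_finrank_eq_two h (hA M hM) h3 h4)
  have hmeet : ∀ L ∈ A, ∀ M ∈ A, L ≠ M → ∃ P, I P L ∧ I P M :=
    fun L hL M hM _ => exists_point_of_finrank_eq_two (hA L hL) (hA M hM)
  obtain ⟨P₀, hP₀, hmod₀⟩ := hss
  have hbdd : BddAbove (multAt A '' SingSet A) :=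
    ⟨A.card, by rintro _ ⟨Q, _, rfl⟩; exact Finset.card_filter_le _ _⟩
  obtain ⟨P, hP, hPm⟩ : maxMult A ∈ multAt A '' SingSet A :=
    Nat.sSup_mem ⟨_, P₀, hP₀, rfl⟩ hbdd
  have hle : multAt A P₀ ≤ multAt A P := hPm ▸ le_csSup hbdd ⟨P₀, hP₀, rfl⟩
  have hmod : ∀ Q, 2 ≤ multAt A Q → Q ≠ P → ∃ L ∈ A, I P L ∧ I Q L :=
    modular_of_card_le_s15 huniq hmeet
      (fun Q hQ hne => ⟨_, hmod₀ Q hQ hne, le_sup_left, le_sup_right⟩) hP hle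
  have hfin : (SingSet A).Finite := finite_setOf_two_le_card (I := I) huniq
  set S := hfin.toFinset with hS
  have hmemS : ∀ Q, Q ∈ S ↔ 2 ≤ multAt A Q := fun Q => hfin.mem_toFinset
  have hSing : (SingSet A).ncard = S.card := Set.ncard_eq_toFinset_card _ hfin
  have hPS : P ∈ S := (hmemS P).2 hP
  have hSing2 : (Sing2Set A).ncard = ((S.erase P).filter (multAt A · = 2)).card := by
    rw [← Set.ncard_coe_finset]
    congr 1
    ext Q
    simp only [Sing2Set, Set.mem_ofPred_eq, Finset.coe_filter, Finset.mem_erase, hmemS]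
    refine ⟨fun h => ⟨⟨?_, h.ge⟩, h⟩, fun h => h.2⟩
    rintro rfl
    omega
  have hcount : ∑ Q ∈ S.erase P, multAt A Q ≤
      (S.erase P).card + multAt A P * (A.filter (¬ I P ·)).card :=
    sum_card_le_of_modular huniq (Finset.notMem_erase P S) fun Q hQ =>
      hmod Q ((hmemS Q).1 (Finset.mem_of_mem_erase hQ)) (Finset.ne_of_mem_erase hQ)
  have hsplit : multAt A P + (A.filter (¬ I P ·)).card = A.card :=
    Finset.card_filter_add_card_filter_not _
  have hthree : 3 * (S.erase P).card ≤
      ∑ Q ∈ S.erase P, multAt A Q + ((S.erase P).filter (multAt A · = 2)).card := by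
    rw [Finset.card_filter, ← Finset.sum_add_distrib, mul_comm, ← smul_eq_mul,
      ← Finset.sum_const]
    refine Finset.sum_le_sum fun Q hQ => ?_
    have := (hmemS Q).1 (Finset.mem_of_mem_erase hQ)
    split_ifs <;> omega
  have hcardS := Finset.card_erase_add_one hPS
  rw [hSing, hSing2, ← hPm, ← hsplit, ← hcardS]
  have hsum := (Nat.cast_le (α := ℤ)).2 (hthree.trans (Nat.add_le_add_right hcount _))
  push_cast at hsum ⊢
  rw [add_sub_cancel_left]
  linarith
end

section
/- Let 𝒜 be a full rank supersolvable line arrangement in the complex projective plane ℙ²(ℂ) with |𝒜| = n ≤ 12. Then |Sing₂(𝒜)| ≥ n/2. -/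
open scoped Classical

/-- The determinant of two vectors of the plane. -/
def planeDet (u w : ℂ × ℂ) : ℂ := u.1 * w.2 - u.2 * w.1

theorem planeDet_anti (u w : ℂ × ℂ) : planeDet u w = - planeDet w u := by
  simp only [planeDet]; ring

theorem planeDet_self (u : ℂ × ℂ) : planeDet u u = 0 := by
  simp only [planeDet]; ring

/-- A nonempty finite set is not invariant under a nonzero translation. -/
theorem eq_zero_of_sub_mem {V : Type*} [AddCommGroup V] [Module ℂ V] [DecidableEq V]
    {T : Finset V} {d : V} (hT : T.Nonempty) (h : ∀ x ∈ T, x - d ∈ T) : d = 0 := by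
  have him : T.image (fun x => x - d) = T := by
    apply Finset.eq_of_subset_of_card_le
    · intro y hy
      obtain ⟨x, hx, rfl⟩ := Finset.mem_image.1 hy
      exact h x hx
    · rw [Finset.card_image_of_injective _ (sub_left_injective)]
  have hsum : ∑ x ∈ T, (x - d) = ∑ x ∈ T, x := by
    conv_rhs => rw [← him]
    rw [Finset.sum_image (fun x _ y _ hxy => sub_left_injective hxy)]
  rw [Finset.sum_sub_distrib, Finset.sum_const, sub_eq_self, ← Nat.cast_smul_eq_nsmul ℂ] at hsum
  exact (smul_eq_zero.1 hsum).resolve_left (by exact_mod_cast hT.card_pos.ne')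

theorem sub_eq_of_planeDet_eq {a b d : ℂ × ℂ} (hbd : planeDet b d ≠ 0)
    (h1 : planeDet a d = planeDet b d) (h2 : planeDet a b = planeDet d b) : a - d = b := by
  simp only [planeDet] at *
  ext
  · apply mul_left_cancel₀ hbd
    simp only [Prod.fst_sub]
    linear_combination b.1 * h1 - d.1 * h2
  · apply mul_left_cancel₀ hbd
    simp only [Prod.snd_sub]
    linear_combination b.2 * h1 - d.2 * h2

theorem eq_of_planeDet_eq {a b d e : ℂ × ℂ} (hde : planeDet d e ≠ 0)
    (h1 : planeDet a d = planeDet b d) (h2 : planeDet a e = planeDet b e) : a = b := by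
  simp only [planeDet] at *
  ext
  · apply mul_left_cancel₀ hde
    linear_combination d.1 * h2 - e.1 * h1
  · apply mul_left_cancel₀ hde
    linear_combination d.2 * h2 - e.2 * h1

theorem false_of_progression {a d e : ℂ × ℂ} (had : planeDet a d ≠ 0)
    (hade : planeDet a e = planeDet d e)
    (hed : planeDet e a = planeDet d a ∨ planeDet e (a + d) = planeDet d (a + d) ∨
      planeDet e (a + d + d) = planeDet d (a + d + d))
    (hae : planeDet a (a + d) = planeDet e (a + d) ∨
      planeDet a (a + d + d) = planeDet e (a + d + d)) : False := by
  obtain ⟨t, ht⟩ : ∃ t : ℂ, e = t • (a - d) := by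
    refine ⟨planeDet e d / planeDet a d, ?_⟩
    simp only [planeDet] at *
    ext
    · simp only [Prod.smul_fst, Prod.fst_sub, smul_eq_mul]
      rw [div_mul_eq_mul_div, eq_div_iff had]
      linear_combination d.1 * hade
    · simp only [Prod.smul_snd, Prod.snd_sub, smul_eq_mul]
      rw [div_mul_eq_mul_div, eq_div_iff had]
      linear_combination d.2 * hade
  have h1 : (t + 1 = 0 ∨ 2 * t + 1 = 0) ∨ 3 * t + 1 = 0 := by
    rw [or_assoc]
    refine hed.imp ?_ (Or.imp ?_ ?_) <;> intro h <;> subst ht <;>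
      refine (mul_eq_zero.1 (?_ : planeDet a d * _ = 0)).resolve_left had <;>
      simp only [planeDet, Prod.smul_fst, Prod.smul_snd, Prod.fst_sub, Prod.snd_sub, Prod.fst_add,
        Prod.snd_add, smul_eq_mul] at * <;> linear_combination h
  have h2 : 2 * t - 1 = 0 ∨ 3 * t - 2 = 0 := by
    refine hae.imp ?_ ?_ <;> intro h <;> subst ht <;>
      refine (mul_eq_zero.1 (?_ : planeDet a d * _ = 0)).resolve_left had <;>
      simp only [planeDet, Prod.smul_fst, Prod.smul_snd, Prod.fst_sub, Prod.snd_sub, Prod.fst_add,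
        Prod.snd_add, smul_eq_mul] at * <;> linear_combination -h
  grind

theorem false_of_triple_four {a b c d : ℂ × ℂ}
    (had : planeDet a d ≠ 0) (hb : planeDet a d = planeDet b d) (hc : planeDet a d = planeDet c d)
    (h1 : planeDet a b = planeDet d b ∨ planeDet a c = planeDet d c)
    (h2 : planeDet b a = planeDet d a ∨ planeDet b c = planeDet d c)
    (h3 : planeDet c a = planeDet d a ∨ planeDet c b = planeDet d b) : False := by
  have key : d = 0 := by
    apply eq_zero_of_sub_mem (T := {a, b, c}) ⟨a, by simp⟩
    simp only [Finset.mem_insert, Finset.mem_singleton]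
    have := @sub_eq_of_planeDet_eq
    grind
  simp [key, planeDet] at had

theorem false_of_triple_five {a b c d e : ℂ × ℂ}
    (hab : a ≠ b) (hac : a ≠ c) (hbc : b ≠ c)
    (had : planeDet a d ≠ 0) (hed0 : planeDet d e ≠ 0)
    (hb : planeDet a d = planeDet b d) (hc : planeDet a d = planeDet c d)
    (h1 : planeDet a b = planeDet d b ∨ planeDet a c = planeDet d c ∨ planeDet a e = planeDet d e)
    (h2 : planeDet b a = planeDet d a ∨ planeDet b c = planeDet d c ∨ planeDet b e = planeDet d e)
    (h3 : planeDet c a = planeDet d a ∨ planeDet c b = planeDet d b ∨ planeDet c e = planeDet d e)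
    (h4 : planeDet e a = planeDet d a ∨ planeDet e b = planeDet d b ∨ planeDet e c = planeDet d c)
    (h5 : planeDet a b = planeDet e b ∨ planeDet a c = planeDet e c ∨ planeDet a d = planeDet e d)
    (h6 : planeDet b a = planeDet e a ∨ planeDet b c = planeDet e c ∨ planeDet b d = planeDet e d)
    (h7 : planeDet c a = planeDet e a ∨ planeDet c b = planeDet e b ∨ planeDet c d = planeDet e d) :
    False := by
  have hd : d ≠ 0 := by rintro rfl; simp [planeDet] at had
  have hs := @sub_eq_of_planeDet_eq
  by_cases he : planeDet a d = planeDet e d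
  · apply hd
    apply eq_zero_of_sub_mem (T := {a, b, c, e}) ⟨a, by simp⟩
    simp only [Finset.mem_insert, Finset.mem_singleton]
    grind
  have hprog : ∀ {x y z : ℂ × ℂ}, x ≠ y → x ≠ z → y ≠ z → planeDet x d ≠ 0 →
      planeDet x d ≠ planeDet e d → planeDet x d = planeDet y d → planeDet x d = planeDet z d →
      planeDet x e = planeDet d e →
      (planeDet y x = planeDet d x ∨ planeDet y z = planeDet d z ∨ planeDet y e = planeDet d e) →
      (planeDet z x = planeDet d x ∨ planeDet z y = planeDet d y ∨ planeDet z e = planeDet d e) →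
      (planeDet e x = planeDet d x ∨ planeDet e y = planeDet d y ∨ planeDet e z = planeDet d z) →
      (planeDet x y = planeDet e y ∨ planeDet x z = planeDet e z ∨ planeDet x d = planeDet e d) →
      False := by
    intro x y z hxy hxz hyz hx hxe hy hz h h2 h3 h4 h5
    have hy' : planeDet y e ≠ planeDet d e := fun q =>
      hxy (eq_of_planeDet_eq hed0 hy (h.trans q.symm))
    have hz' : planeDet z e ≠ planeDet d e := fun q =>
      hxz (eq_of_planeDet_eq hed0 hz (h.trans q.symm))
    have h2' : y - d = x ∨ y - d = z := by
      rcases h2 with q | q | q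
      · exact Or.inl (hs hx hy.symm q)
      · exact Or.inr (hs (hz ▸ hx) (hy.symm.trans hz) q)
      · exact absurd q hy'
    have h3' : z - d = x ∨ z - d = y := by
      rcases h3 with q | q | q
      · exact Or.inl (hs hx hz.symm q)
      · exact Or.inr (hs (hy ▸ hx) (hz.symm.trans hy) q)
      · exact absurd q hz'
    rcases h2' with q | q <;> rcases h3' with r | r
    · exact hyz (sub_left_injective (q.trans r.symm))
    · obtain rfl : y = x + d := by rw [← q]; abel
      obtain rfl : z = x + d + d := by rw [← r]; abel
      exact false_of_progression hx h h4 (h5.imp_right (Or.resolve_right · hxe))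
    · obtain rfl : z = x + d := by rw [← r]; abel
      obtain rfl : y = x + d + d := by rw [← q]; abel
      exact false_of_progression hx h (h4.imp_right Or.symm)
        (((or_left_comm.1 h5).imp_right (Or.resolve_right · hxe)))
    · apply hd
      apply eq_zero_of_sub_mem (T := {y, z}) ⟨y, by simp⟩
      simp [q, r]
  have hbe : planeDet b d ≠ planeDet e d := hb ▸ he
  have hce : planeDet c d ≠ planeDet e d := hc ▸ he
  by_cases ha : planeDet a e = planeDet d e
  · exact hprog hab hac hbc had he hb hc ha h2 h3 h4 h5
  by_cases hb' : planeDet b e = planeDet d e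
  · exact hprog hab.symm hbc hac (hb ▸ had) hbe hb.symm (hb.symm.trans hc) hb' h1
      (or_left_comm.1 h3) (or_left_comm.1 h4) h6
  by_cases hc' : planeDet c e = planeDet d e
  · exact hprog hac.symm hbc.symm hab (hc ▸ had) hce hc.symm (hc.symm.trans hb) hc'
      (or_left_comm.1 h1) (or_left_comm.1 h2) (or_rotate.2 h4) h7
  exact false_of_triple_four had hb hc (h1.imp_right (Or.resolve_right · ha))
    (h2.imp_right (Or.resolve_right · hb')) (h3.imp_right (Or.resolve_right · hc'))

theorem exists_triple_five (D : Fin 5 → Fin 5 → ℂ) (ha : ∀ i j, D i j = - D j i)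
    (hn : ∀ i j, i ≠ j → D i j ≠ 0) (h : ∀ i j, i ≠ j → ∃ l, D i l = D j l)
    (ht : ∀ i j k l, i ≠ j → i ≠ k → j ≠ k → D i l = D j l → D i l = D k l → False) : False := by
  have h0 : ∀ i, D i i = 0 := fun i => by have := ha i i; grind
  choose! s hs using h
  have s1 : ∀ i j, i ≠ j → s i j ≠ i ∧ s i j ≠ j := by
    intro i j hij
    have := hs i j hij
    constructor <;> intro h1 <;> rw [h1, h0] at this
    exacts [hn j i hij.symm this.symm, hn i j hij this]
  have s2 : ∀ i j k, i < j → j < k → s i j ≠ s i k ∧ s i j ≠ s j k ∧ s i k ≠ s j k := by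
    intro i j k hij hjk
    have h1 := hs i j hij.ne
    have h2 := hs i k (hij.trans hjk).ne
    have h3 := hs j k hjk.ne
    have h4 := fun l => ht i j k l hij.ne (hij.trans hjk).ne hjk.ne
    grind
  have c01 : s 0 1 = 2 ∨ s 0 1 = 3 ∨ s 0 1 = 4 := by have := s1 0 1; grind
  have c02 : s 0 2 = 1 ∨ s 0 2 = 3 ∨ s 0 2 = 4 := by have := s1 0 2; grind
  have c03 : s 0 3 = 1 ∨ s 0 3 = 2 ∨ s 0 3 = 4 := by have := s1 0 3; grind
  have c04 : s 0 4 = 1 ∨ s 0 4 = 2 ∨ s 0 4 = 3 := by have := s1 0 4; grind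
  have c12 : s 1 2 = 0 ∨ s 1 2 = 3 ∨ s 1 2 = 4 := by have := s1 1 2; grind
  have c13 : s 1 3 = 0 ∨ s 1 3 = 2 ∨ s 1 3 = 4 := by have := s1 1 3; grind
  have c14 : s 1 4 = 0 ∨ s 1 4 = 2 ∨ s 1 4 = 3 := by have := s1 1 4; grind
  have c23 : s 2 3 = 0 ∨ s 2 3 = 1 ∨ s 2 3 = 4 := by have := s1 2 3; grind
  have c24 : s 2 4 = 0 ∨ s 2 4 = 1 ∨ s 2 4 = 3 := by have := s1 2 4; grind
  have c34 : s 3 4 = 0 ∨ s 3 4 = 1 ∨ s 3 4 = 2 := by have := s1 3 4; grind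
  have n012 := s2 0 1 2 (by decide) (by decide)
  have n013 := s2 0 1 3 (by decide) (by decide)
  have n014 := s2 0 1 4 (by decide) (by decide)
  have n023 := s2 0 2 3 (by decide) (by decide)
  have n024 := s2 0 2 4 (by decide) (by decide)
  have n034 := s2 0 3 4 (by decide) (by decide)
  have n123 := s2 1 2 3 (by decide) (by decide)
  have n124 := s2 1 2 4 (by decide) (by decide)
  have n134 := s2 1 3 4 (by decide) (by decide)
  have n234 := s2 2 3 4 (by decide) (by decide)
  have e01 := hs 0 1 (by decide)
  have e02 := hs 0 2 (by decide)
  have e03 := hs 0 3 (by decide)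
  have e04 := hs 0 4 (by decide)
  have e12 := hs 1 2 (by decide)
  have e13 := hs 1 3 (by decide)
  have e14 := hs 1 4 (by decide)
  have e23 := hs 2 3 (by decide)
  have e24 := hs 2 4 (by decide)
  have e34 := hs 3 4 (by decide)
  have a01 := ha 0 1
  have z01 := hn 0 1 (by decide)
  have a02 := ha 0 2
  have z02 := hn 0 2 (by decide)
  have a03 := ha 0 3
  have z03 := hn 0 3 (by decide)
  have a04 := ha 0 4
  have z04 := hn 0 4 (by decide)
  have a12 := ha 1 2
  have z12 := hn 1 2 (by decide)
  have a13 := ha 1 3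
  have z13 := hn 1 3 (by decide)
  have a14 := ha 1 4
  have z14 := hn 1 4 (by decide)
  have a23 := ha 2 3
  have z23 := hn 2 3 (by decide)
  have a24 := ha 2 4
  have z24 := hn 2 4 (by decide)
  have a34 := ha 3 4
  have z34 := hn 3 4 (by decide)
  clear hs s1 s2 ha hn ht h0
  generalize s 0 1 = s01, s 0 2 = s02, s 0 3 = s03, s 0 4 = s04, s 1 2 = s12,
    s 1 3 = s13, s 1 4 = s14, s 2 3 = s23, s 2 4 = s24, s 3 4 = s34 at *
  grind

theorem cover_four : ∀ {i j k l : Fin 4}, i ≠ j → i ≠ k → j ≠ k → l ≠ i → l ≠ j → l ≠ k →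
    ∀ z, z = i ∨ z = j ∨ z = k ∨ z = l := by
  decide

theorem cover_five {i j k l e : Fin 5} (h1 : i ≠ j) (h2 : i ≠ k) (h3 : j ≠ k) (h4 : l ≠ i)
    (h5 : l ≠ j) (h6 : l ≠ k) (h7 : e ≠ i) (h8 : e ≠ j) (h9 : e ≠ k) (h10 : e ≠ l) (z : Fin 5) :
    z = i ∨ z = j ∨ z = k ∨ z = l ∨ z = e := by
  have hu : ({i, j, k, l, e} : Finset (Fin 5)) = Finset.univ := by
    rw [← Finset.card_eq_iff_eq_univ]
    simp [h1, h2, h3, h4.symm, h5.symm, h6.symm, h7.symm, h8.symm, h9.symm, h10.symm]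
  simpa using hu.symm.subset (Finset.mem_univ z)

theorem exists_triple_four (D : Fin 4 → Fin 4 → ℂ) (ha : ∀ i j, D i j = - D j i)
    (hn : ∀ i j, i ≠ j → D i j ≠ 0) (h : ∀ i j, i ≠ j → ∃ l, D i l = D j l)
    (ht : ∀ i j k l, i ≠ j → i ≠ k → j ≠ k → D i l = D j l → D i l = D k l → False) : False := by
  have h0 : ∀ i, D i i = 0 := fun i => by have := ha i i; grind
  choose! s hs using h
  have s1 : ∀ i j, i ≠ j → s i j ≠ i ∧ s i j ≠ j := by
    intro i j hij
    have := hs i j hij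
    constructor <;> intro h1 <;> rw [h1, h0] at this
    exacts [hn j i hij.symm this.symm, hn i j hij this]
  have s2 : ∀ i j k, i < j → j < k → s i j ≠ s i k ∧ s i j ≠ s j k ∧ s i k ≠ s j k := by
    intro i j k hij hjk
    have h1 := hs i j hij.ne
    have h2 := hs i k (hij.trans hjk).ne
    have h3 := hs j k hjk.ne
    have h4 := fun l => ht i j k l hij.ne (hij.trans hjk).ne hjk.ne
    grind
  have c01 : s 0 1 = 2 ∨ s 0 1 = 3 := by have := s1 0 1; grind
  have c02 : s 0 2 = 1 ∨ s 0 2 = 3 := by have := s1 0 2; grind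
  have c03 : s 0 3 = 1 ∨ s 0 3 = 2 := by have := s1 0 3; grind
  have c12 : s 1 2 = 0 ∨ s 1 2 = 3 := by have := s1 1 2; grind
  have c13 : s 1 3 = 0 ∨ s 1 3 = 2 := by have := s1 1 3; grind
  have c23 : s 2 3 = 0 ∨ s 2 3 = 1 := by have := s1 2 3; grind
  have n012 := s2 0 1 2 (by decide) (by decide)
  have n013 := s2 0 1 3 (by decide) (by decide)
  have n023 := s2 0 2 3 (by decide) (by decide)
  have n123 := s2 1 2 3 (by decide) (by decide)
  have := hn 0 1
  grind

theorem false_of_all_directions {m : ℕ} (hm2 : 2 ≤ m) (hm5 : m ≤ 5) (v : Fin m → ℂ × ℂ)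
    (hn : ∀ i j, i ≠ j → planeDet (v i) (v j) ≠ 0)
    (h : ∀ i j, i ≠ j → ∃ l, planeDet (v i) (v l) = planeDet (v j) (v l)) : False := by
  have ha : ∀ i j, planeDet (v i) (v j) = - planeDet (v j) (v i) := fun i j => planeDet_anti _ _
  have h0 : ∀ i, planeDet (v i) (v i) = 0 := fun i => planeDet_self _
  have hl : ∀ {i j l}, i ≠ j → planeDet (v i) (v l) = planeDet (v j) (v l) → l ≠ i ∧ l ≠ j := by
    intro i j l hij q
    constructor <;> rintro rfl
    · exact hn _ _ hij.symm (q.symm.trans (h0 _))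
    · exact hn _ _ hij (q.trans (h0 _))
  have hinj : ∀ {i j}, i ≠ j → v i ≠ v j := fun hij q => hn _ _ hij (by rw [q, h0])
  interval_cases m
  · obtain ⟨l, q⟩ := h 0 1 (by decide)
    have := hl (by decide) q
    omega
  · have p : ∀ i j k : Fin 3, i ≠ j → i ≠ k → j ≠ k →
        planeDet (v i) (v k) = planeDet (v j) (v k) := by
      intro i j k hij hik hjk
      obtain ⟨l, q⟩ := h i j hij
      obtain rfl : l = k := by have := hl hij q; omega
      exact q
    have := p 0 1 2 (by decide) (by decide) (by decide)
    have := p 0 2 1 (by decide) (by decide) (by decide)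
    have := p 1 2 0 (by decide) (by decide) (by decide)
    have := hn 0 1 (by decide)
    grind
  · refine exists_triple_four _ ha hn h fun i j k l hij hik hjk q1 q2 => ?_
    have hcov : ∀ z, z = i ∨ z = j ∨ z = k ∨ z = l :=
      cover_four hij hik hjk (hl hij q1).1 (hl hij q1).2 (hl hik q2).2
    have pick : ∀ x y p q, x ≠ y → (∀ z, z = x ∨ z = y ∨ z = p ∨ z = q) →
        planeDet (v x) (v p) = planeDet (v y) (v p) ∨
        planeDet (v x) (v q) = planeDet (v y) (v q) := by
      intro x y p q hxy hz
      obtain ⟨z, e⟩ := h x y hxy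
      have := hl hxy e
      rcases hz z with hz | hz | hz | hz
      exacts [absurd hz this.1, absurd hz this.2, Or.inl (hz ▸ e), Or.inr (hz ▸ e)]
    have h1 := hl hij q1
    have h2 := hl hik q2
    exact false_of_triple_four (hn i l h1.1.symm) q1 q2
      (pick i l j k h1.1.symm (by simpa only [or_comm, or_left_comm] using hcov))
      (pick j l i k h1.2.symm (by simpa only [or_comm, or_left_comm] using hcov))
      (pick k l i j h2.2.symm (by simpa only [or_comm, or_left_comm] using hcov))
  · refine exists_triple_five _ ha hn h fun i j k l hij hik hjk q1 q2 => ?_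
    have h1 := hl hij q1
    have h2 := hl hik q2
    obtain ⟨e, he1, he2, he3, he4⟩ : ∃ e, e ≠ i ∧ e ≠ j ∧ e ≠ k ∧ e ≠ l := by
      clear * -
      revert i j k l
      decide
    have hcov := cover_five hij hik hjk h1.1 h1.2 h2.2 he1 he2 he3 he4
    have pick : ∀ x y p q r, x ≠ y → (∀ z, z = x ∨ z = y ∨ z = p ∨ z = q ∨ z = r) →
        planeDet (v x) (v p) = planeDet (v y) (v p) ∨
        planeDet (v x) (v q) = planeDet (v y) (v q) ∨
        planeDet (v x) (v r) = planeDet (v y) (v r) := by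
      intro x y p q r hxy hz
      obtain ⟨z, e⟩ := h x y hxy
      have := hl hxy e
      rcases hz z with hz | hz | hz | hz | hz
      exacts [absurd hz this.1, absurd hz this.2, Or.inl (hz ▸ e), Or.inr (Or.inl (hz ▸ e)),
        Or.inr (Or.inr (hz ▸ e))]
    exact false_of_triple_five (hinj hij) (hinj hik) (hinj hjk) (hn i l h1.1.symm)
      (hn l e he4.symm) q1 q2
      (pick i l j k e h1.1.symm (by simpa only [or_comm, or_left_comm] using hcov))
      (pick j l i k e h1.2.symm (by simpa only [or_comm, or_left_comm] using hcov))
      (pick k l i j e h2.2.symm (by simpa only [or_comm, or_left_comm] using hcov))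
      (pick e l i j k he4 (by simpa only [or_comm, or_left_comm] using hcov))
      (pick i e j k l he1.symm (by simpa only [or_comm, or_left_comm] using hcov))
      (pick j e i k l he2.symm (by simpa only [or_comm, or_left_comm] using hcov))
      (pick k e i j l he3.symm (by simpa only [or_comm, or_left_comm] using hcov))

section Incidence

variable {K : Type*} [Field K]

theorem rep_mem_iff (P : Pt K) (L : Submodule K (Fin 3 → K)) :
    P.rep ∈ L ↔ P.submodule ≤ L := by
  rw [P.submodule_eq, Submodule.span_singleton_le_iff_mem]

theorem finrank_inf_eq_one {L M : Submodule K (Fin 3 → K)} (hL : Module.finrank K L = 2)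
    (hM : Module.finrank K M = 2) (hLM : L ≠ M) : Module.finrank K ↥(L ⊓ M) = 1 := by
  have h1 := Submodule.finrank_sup_add_finrank_inf_eq L M
  have h2 : Module.finrank K ↥(L ⊔ M) ≤ 3 := by
    simpa using Submodule.finrank_le (L ⊔ M)
  have h3 : Module.finrank K ↥(L ⊓ M) < 2 := by
    by_contra! h
    have hl := Submodule.eq_of_le_of_finrank_le (inf_le_left : L ⊓ M ≤ L) (hL ▸ h)
    have hr := Submodule.eq_of_le_of_finrank_le (inf_le_right : L ⊓ M ≤ M) (hM ▸ h)
    exact hLM (hl.symm.trans hr)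
  omega

theorem exists_submodule_eq_inf {L M : Submodule K (Fin 3 → K)} (hL : Module.finrank K L = 2)
    (hM : Module.finrank K M = 2) (hLM : L ≠ M) : ∃ Q : Pt K, Q.submodule = L ⊓ M :=
  ⟨Projectivization.mk'' _ (finrank_inf_eq_one hL hM hLM), Projectivization.submodule_mk'' _ _⟩

theorem submodule_eq_inf {L M : Submodule K (Fin 3 → K)} (hL : Module.finrank K L = 2)
    (hM : Module.finrank K M = 2) (hLM : L ≠ M) {Q : Pt K} (h1 : Q.submodule ≤ L)
    (h2 : Q.submodule ≤ M) : Q.submodule = L ⊓ M :=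
  Submodule.eq_of_le_of_finrank_eq (le_inf h1 h2)
    (Q.finrank_submodule.trans (finrank_inf_eq_one hL hM hLM).symm)

theorem line_eq_of_two_points {L M : Submodule K (Fin 3 → K)} (hL : Module.finrank K L = 2)
    (hM : Module.finrank K M = 2) {P Q : Pt K} (hPQ : P ≠ Q) (hPL : P.submodule ≤ L)
    (hPM : P.submodule ≤ M) (hQL : Q.submodule ≤ L) (hQM : Q.submodule ≤ M) : L = M := by
  by_contra h
  exact hPQ (Projectivization.submodule_injective
    ((submodule_eq_inf hL hM h hPL hPM).trans (submodule_eq_inf hL hM h hQL hQM).symm))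

theorem point_eq_of_two_lines {L M : Submodule K (Fin 3 → K)} (hL : Module.finrank K L = 2)
    (hM : Module.finrank K M = 2) (hLM : L ≠ M) {P Q : Pt K} (hPL : P.submodule ≤ L)
    (hPM : P.submodule ≤ M) (hQL : Q.submodule ≤ L) (hQM : Q.submodule ≤ M) : P = Q := by
  by_contra h
  exact hLM (line_eq_of_two_points hL hM h hPL hPM hQL hQM)

/-- A line missing a vector `p` is the kernel of a functional normalized by `p`. -/
theorem exists_functional {L : Submodule K (Fin 3 → K)} (hL : Module.finrank K L = 2)
    {p : Fin 3 → K} (hp : p ∉ L) :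
    ∃ f : (Fin 3 → K) →ₗ[K] K, f p = 1 ∧ ∀ x, f x = 0 ↔ x ∈ L := by
  obtain ⟨f, hfp, hfL⟩ := Submodule.exists_le_ker_of_notMem hp
  have hker : L = LinearMap.ker f := by
    apply Submodule.eq_of_le_of_finrank_le hfL
    have h1 := f.finrank_range_add_finrank_ker
    have h2 : 0 < Module.finrank K (LinearMap.range f) := by
      rw [Module.finrank_pos_iff, Submodule.nontrivial_iff_ne_bot, Ne, LinearMap.range_eq_bot]
      rintro rfl
      exact hfp rfl
    simp only [Module.finrank_fin_fun] at h1
    omega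
  refine ⟨(f p)⁻¹ • f, by simp [hfp], fun x => ?_⟩
  rw [hker]
  simp [hfp]

theorem finite_sing2Set {A : Arr K} (hA : IsLineArr A) : (Sing2Set A).Finite := by
  refine Set.Finite.of_injOn (f := fun Q : Pt K => A.filter fun L => Q.submodule ≤ L)
    (t := (A.powerset : Set (Arr K))) ?_ ?_ A.powerset.finite_toSet
  · intro Q _
    exact Finset.mem_coe.2 (Finset.mem_powerset.2 (Finset.filter_subset _ _))
  · intro Q hQ R hR hQR
    obtain ⟨L, M, hLM, hf⟩ := Finset.card_eq_two.1 hQ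
    have hQ' : ∀ X ∈ ({L, M} : Arr K), X ∈ A ∧ Q.submodule ≤ X := fun X hX =>
      Finset.mem_filter.1 (hf ▸ hX)
    have hf' : (A.filter fun L => R.submodule ≤ L) = {L, M} := hQR.symm.trans hf
    have hR' : ∀ X ∈ ({L, M} : Arr K), X ∈ A ∧ R.submodule ≤ X := fun X hX =>
      Finset.mem_filter.1 (hf' ▸ hX)
    have hL : L ∈ ({L, M} : Arr K) := by simp
    have hM : M ∈ ({L, M} : Arr K) := by simp
    exact point_eq_of_two_lines (hA _ (hQ' L hL).1) (hA _ (hQ' M hM).1) hLM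
      (hQ' L hL).2 (hQ' M hM).2 (hR' L hL).2 (hR' M hM).2

/-- The lines of `A` through `P`. -/
noncomputable def linesThrough (A : Arr K) (P : Pt K) : Arr K :=
  A.filter fun L => P.submodule ≤ L

/-- The lines of `A` missing `P`. -/
noncomputable def linesMissing (A : Arr K) (P : Pt K) : Arr K :=
  A.filter fun L => ¬ P.submodule ≤ L

/-- The lines of `A` through `P` that meet `L` in a point on no further line of `A`. -/
noncomputable def simpleLines (A : Arr K) (P : Pt K) (L : Submodule K (Fin 3 → K)) : Arr K :=
  (linesThrough A P).filter fun M => ∀ X ∈ A, L ⊓ M ≤ X → X = L ∨ X = M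

theorem ne_of_through_of_missing {A : Arr K} {P : Pt K} {L M : Submodule K (Fin 3 → K)}
    (hL : L ∈ linesMissing A P) (hM : M ∈ linesThrough A P) : L ≠ M := by
  rintro rfl
  exact (Finset.mem_filter.1 hL).2 (Finset.mem_filter.1 hM).2

theorem sum_card_simpleLines_le {A : Arr K} (hA : IsLineArr A) (P : Pt K) :
    ∑ L ∈ linesMissing A P, (simpleLines A P L).card ≤ (Sing2Set A).ncard := by
  rw [← Finset.card_sigma, ← Set.ncard_coe_finset]
  have key : ∀ x : (_ : Submodule K (Fin 3 → K)) × Submodule K (Fin 3 → K),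
      x ∈ (linesMissing A P).sigma (simpleLines A P) →
      ∃ Q : Pt K, (A.filter fun L => Q.submodule ≤ L) = {x.1, x.2} ∧ x.1 ≠ x.2 := by
    rintro ⟨L, M⟩ hx
    obtain ⟨hL, hM⟩ := Finset.mem_sigma.1 hx
    obtain ⟨hM, hs⟩ := Finset.mem_filter.1 hM
    have hLM := ne_of_through_of_missing hL hM
    have hLA := (Finset.mem_filter.1 hL).1
    have hMA := (Finset.mem_filter.1 hM).1
    obtain ⟨Q, hQ⟩ := exists_submodule_eq_inf (hA _ hLA) (hA _ hMA) hLM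
    refine ⟨Q, ?_, hLM⟩
    ext X
    simp only [Finset.mem_filter, Finset.mem_insert, Finset.mem_singleton, hQ]
    constructor
    · exact fun h => hs X h.1 h.2
    · rintro (rfl | rfl)
      exacts [⟨hLA, inf_le_left⟩, ⟨hMA, inf_le_right⟩]
  choose! f hf hne using key
  refine Set.ncard_le_ncard_of_injOn f ?_ ?_ (finite_sing2Set hA)
  · intro x hx
    show (A.filter fun L => (f x).submodule ≤ L).card = 2
    rw [hf x hx, Finset.card_pair (hne x hx)]
  · rintro ⟨L, M⟩ hx ⟨L', M'⟩ hy hxy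
    have h : ({L, M} : Arr K) = {L', M'} := by
      have h1 := hf _ hx
      have h2 := hf _ hy
      rw [hxy] at h1
      exact h1.symm.trans h2
    obtain ⟨hL, hM⟩ := Finset.mem_sigma.1 hx
    obtain ⟨hL', hM'⟩ := Finset.mem_sigma.1 hy
    have hLM' := ne_of_through_of_missing hL (Finset.mem_filter.1 hM').1
    have hL'M := ne_of_through_of_missing hL' (Finset.mem_filter.1 hM).1
    obtain rfl : L = L' := by
      have : L ∈ ({L', M'} : Arr K) := h ▸ (by simp)
      simpa [hLM'] using this
    obtain rfl : M = M' := by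
      have : M ∈ ({L, M'} : Arr K) := h ▸ (by simp)
      simpa [hL'M.symm] using this
    rfl

/-- A line through `P` meeting `L` in a point of multiplicity at least three also meets there a
second line missing `P`. -/
theorem exists_third_line {A : Arr K} (hA : IsLineArr A) {P : Pt K}
    {L M : Submodule K (Fin 3 → K)} (hL : L ∈ linesMissing A P) (hM : M ∈ linesThrough A P)
    (hs : M ∉ simpleLines A P L) : ∃ X ∈ linesMissing A P, X ≠ L ∧ L ⊓ M ≤ X := by
  have hn : ∃ X ∈ A, L ⊓ M ≤ X ∧ X ≠ L ∧ X ≠ M := by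
    by_contra! h
    refine hs (Finset.mem_filter.2 ⟨hM, fun X hX hle => ?_⟩)
    by_contra! h'
    exact h'.2 (h X hX hle h'.1)
  obtain ⟨X, hX, hle, hXL, hXM⟩ := hn
  obtain ⟨hLA, hPL⟩ := Finset.mem_filter.1 hL
  obtain ⟨hMA, hPM⟩ := Finset.mem_filter.1 hM
  refine ⟨X, Finset.mem_filter.2 ⟨hX, fun hPX => ?_⟩, hXL, hle⟩
  obtain ⟨Q, hQ⟩ := exists_submodule_eq_inf (hA _ hLA) (hA _ hMA) (ne_of_through_of_missing hL hM)
  refine hPL ?_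
  obtain rfl := point_eq_of_two_lines (hA _ hX) (hA _ hMA) hXM hPX hPM (hQ.trans_le hle)
    (hQ.trans_le inf_le_right)
  exact hQ.trans_le inf_le_left

theorem eq_of_common_third_line {A : Arr K} (hA : IsLineArr A) {P : Pt K}
    {L M M' X : Submodule K (Fin 3 → K)} (hL : L ∈ linesMissing A P)
    (hM : M ∈ linesThrough A P) (hM' : M' ∈ linesThrough A P) (hX : X ∈ linesMissing A P)
    (hXL : X ≠ L) (h : L ⊓ M ≤ X) (h' : L ⊓ M' ≤ X) : M = M' := by
  obtain ⟨hLA, hPL⟩ := Finset.mem_filter.1 hL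
  obtain ⟨hMA, hPM⟩ := Finset.mem_filter.1 hM
  obtain ⟨hMA', hPM'⟩ := Finset.mem_filter.1 hM'
  obtain ⟨Q, hQ⟩ := exists_submodule_eq_inf (hA _ hLA) (hA _ hMA) (ne_of_through_of_missing hL hM)
  obtain ⟨R, hR⟩ :=
    exists_submodule_eq_inf (hA _ hLA) (hA _ hMA') (ne_of_through_of_missing hL hM')
  obtain rfl := point_eq_of_two_lines (hA _ (Finset.mem_filter.1 hX).1) (hA _ hLA) hXL
    (hQ.trans_le h) (hQ.trans_le inf_le_left) (hR.trans_le h') (hR.trans_le inf_le_left)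
  refine line_eq_of_two_points (hA _ hMA) (hA _ hMA') (P := P) (Q := Q) ?_ hPM hPM'
    (hQ.trans_le inf_le_right) (hR.trans_le inf_le_right)
  rintro rfl
  exact hPL (hQ.trans_le inf_le_left)

theorem card_linesThrough_lt {A : Arr K} (hA : IsLineArr A) {P : Pt K}
    {L : Submodule K (Fin 3 → K)} (hL : L ∈ linesMissing A P) :
    (linesThrough A P).card < (simpleLines A P L).card + (linesMissing A P).card := by
  have h1 : (linesThrough A P \ simpleLines A P L).card ≤ ((linesMissing A P).erase L).card := by
    have key : ∀ M ∈ linesThrough A P \ simpleLines A P L,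
        ∃ X ∈ linesMissing A P, X ≠ L ∧ L ⊓ M ≤ X := fun M hM =>
      exists_third_line hA hL (Finset.mem_sdiff.1 hM).1 (Finset.mem_sdiff.1 hM).2
    choose! f hf hne hle using key
    refine Finset.card_le_card_of_injOn f
      (fun M hM => Finset.mem_erase.2 ⟨hne M hM, hf M hM⟩) fun M hM M' hM' h => ?_
    exact eq_of_common_third_line hA hL (Finset.mem_sdiff.1 hM).1 (Finset.mem_sdiff.1 hM').1
      (hf M hM) (hne M hM) (hle M hM) (h ▸ hle M' hM')
  rw [Finset.card_erase_of_mem hL] at h1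
  have h2 := Finset.le_card_sdiff (simpleLines A P L) (linesThrough A P)
  have h3 := Finset.card_pos.2 ⟨L, hL⟩
  omega

end Incidence

theorem exists_eq_mul_planeDet {w : ℂ × ℂ} (hw : w ≠ 0) (f : (ℂ × ℂ) →ₗ[ℂ] ℂ) (hf : f w = 0) :
    ∃ c : ℂ, ∀ u, f u = c * planeDet w u := by
  have hexp : ∀ u : ℂ × ℂ, f u = u.1 * f (1, 0) + u.2 * f (0, 1) := by
    intro u
    rw [← smul_eq_mul, ← smul_eq_mul, ← map_smul, ← map_smul, ← map_add]
    simp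
  rw [hexp] at hf
  by_cases h1 : w.1 = 0
  · have h2 : w.2 ≠ 0 := fun h2 => hw (Prod.ext h1 h2)
    refine ⟨-f (1, 0) / w.2, fun u => ?_⟩
    rw [hexp u, planeDet]
    field_simp
    rw [h1] at hf ⊢
    linear_combination u.2 * hf
  · refine ⟨f (0, 1) / w.1, fun u => ?_⟩
    rw [hexp u, planeDet]
    field_simp
    linear_combination u.1 * hf

theorem simpleLines_nonempty {A : Arr ℂ} (hA : IsLineArr A) {P : Pt ℂ} (hP : IsModular A P)
    (hm : (linesThrough A P).card ≤ 5) {L : Submodule ℂ (Fin 3 → ℂ)}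
    (hL : L ∈ linesMissing A P) : (simpleLines A P L).Nonempty := by
  by_contra hemp
  rw [Finset.not_nonempty_iff_eq_empty] at hemp
  obtain ⟨hLA, hPL⟩ := Finset.mem_filter.1 hL
  let M : Fin (linesThrough A P).card → Submodule ℂ (Fin 3 → ℂ) :=
    fun i => ((linesThrough A P).equivFin.symm i : _)
  have hM : ∀ i, M i ∈ linesThrough A P := fun i => ((linesThrough A P).equivFin.symm i).2
  have hMinj : Function.Injective M :=
    Subtype.val_injective.comp (linesThrough A P).equivFin.symm.injective
  have hMsurj : ∀ X ∈ linesThrough A P, ∃ i, M i = X := fun X hX =>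
    ⟨(linesThrough A P).equivFin ⟨X, hX⟩, by simp [M]⟩
  have hX : ∀ i, ∃ X ∈ linesMissing A P, X ≠ L ∧ L ⊓ M i ≤ X := fun i =>
    exists_third_line hA hL (hM i) (by simp [hemp])
  choose X hX hXL hle using hX
  have hQ : ∀ i, ∃ Q : Pt ℂ, Q.submodule = L ⊓ M i := fun i =>
    exists_submodule_eq_inf (hA _ hLA) (hA _ (Finset.mem_filter.1 (hM i)).1)
      (ne_of_through_of_missing hL (hM i))
  choose Q hQ using hQ
  have hf : ∀ i, ∃ f : (Fin 3 → ℂ) →ₗ[ℂ] ℂ, f P.rep = 1 ∧ ∀ x, f x = 0 ↔ x ∈ X i := fun i =>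
    exists_functional (hA _ (Finset.mem_filter.1 (hX i)).1)
      (mt (rep_mem_iff _ _).1 (Finset.mem_filter.1 (hX i)).2)
  choose f hfp hfX using hf
  have hQL : ∀ i, (Q i).rep ∈ L := fun i => (rep_mem_iff _ _).2 ((hQ i).trans_le inf_le_left)
  have hQM : ∀ i, (Q i).rep ∈ M i := fun i => (rep_mem_iff _ _).2 ((hQ i).trans_le inf_le_right)
  have hQX : ∀ i, (Q i).rep ∈ X i := fun i => (rep_mem_iff _ _).2 ((hQ i).trans_le (hle i))
  have hfQ : ∀ i j, i ≠ j → f i (Q j).rep ≠ 0 := by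
    intro i j hij h
    rw [hfX, rep_mem_iff, hQ] at h
    exact hij (hMinj (eq_of_common_third_line hA hL (hM i) (hM j) (hX i) (hXL i) (hle i) h))
  obtain ⟨e⟩ : Nonempty (L ≃ₗ[ℂ] ℂ × ℂ) :=
    FiniteDimensional.nonempty_linearEquiv_of_finrank_eq (by rw [hA _ hLA]; simp)
  let w : Fin (linesThrough A P).card → ℂ × ℂ := fun i => e ⟨(Q i).rep, hQL i⟩
  have hw : ∀ i, w i ≠ 0 := by
    intro i h
    have := (LinearEquiv.map_eq_zero_iff e).1 h
    exact (Q i).rep_nonzero (congrArg Subtype.val this)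
  have hc : ∀ i, ∃ c : ℂ, ∀ u, f i (e.symm u : Fin 3 → ℂ) = c * planeDet (w i) u := fun i =>
    exists_eq_mul_planeDet (hw i) (f i ∘ₗ L.subtype ∘ₗ e.symm.toLinearMap)
      (by simpa [w] using (hfX i _).2 (hQX i))
  choose c hc using hc
  have hc0 : ∀ i, c i ≠ 0 := by
    intro i h
    refine hXL i (Submodule.eq_of_le_of_finrank_eq (fun x hx => ?_)
      ((hA _ hLA).trans (hA _ (Finset.mem_filter.1 (hX i)).1).symm)).symm
    have := hc i (e ⟨x, hx⟩)
    rw [h, zero_mul, LinearEquiv.symm_apply_apply] at this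
    exact (hfX i x).1 this
  have hdet : ∀ i j, planeDet (c i • w i) (c j • w j) = c j * f i (Q j).rep := by
    intro i j
    have := hc i (w j)
    simp only [w, LinearEquiv.symm_apply_apply] at this
    rw [this]
    simp only [planeDet, Prod.smul_fst, Prod.smul_snd, smul_eq_mul]
    ring
  refine false_of_all_directions (m := (linesThrough A P).card) hP.1 hm (fun i => c i • w i) ?_ ?_
  · intro i j hij
    rw [hdet]
    exact mul_ne_zero (hc0 j) (hfQ i j hij)
  · intro i j hij
    obtain ⟨hXi, hPi⟩ := Finset.mem_filter.1 (hX i)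
    obtain ⟨hXj, -⟩ := Finset.mem_filter.1 (hX j)
    have hXX : X i ≠ X j := by
      intro h
      exact hfQ i j hij ((hfX i _).2 (h ▸ hQX j))
    obtain ⟨R, hR⟩ := exists_submodule_eq_inf (hA _ hXi) (hA _ hXj) hXX
    have hRP : R ≠ P := by
      rintro rfl
      exact hPi (hR.trans_le inf_le_left)
    have hRS : R ∈ SingSet A := by
      show 2 ≤ (A.filter fun L => R.submodule ≤ L).card
      rw [← Finset.card_pair hXX]
      apply Finset.card_le_card
      intro Y hY
      rcases Finset.mem_insert.1 hY with rfl | hY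
      · exact Finset.mem_filter.2 ⟨hXi, hR.trans_le inf_le_left⟩
      · obtain rfl := Finset.mem_singleton.1 hY
        exact Finset.mem_filter.2 ⟨hXj, hR.trans_le inf_le_right⟩
    obtain ⟨l, hl⟩ := hMsurj _ (Finset.mem_filter.2 ⟨hP.2 R hRS hRP, le_sup_left⟩)
    refine ⟨l, ?_⟩
    rw [hdet, hdet]
    congr 1
    have hmem := hQM l
    rw [hl, P.submodule_eq, R.submodule_eq, Submodule.mem_sup] at hmem
    obtain ⟨y, hy, z, hz, hyz⟩ := hmem
    obtain ⟨a, rfl⟩ := Submodule.mem_span_singleton.1 hy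
    obtain ⟨b, rfl⟩ := Submodule.mem_span_singleton.1 hz
    have hi : f i R.rep = 0 := (hfX i _).2 ((rep_mem_iff _ _).2 (hR.trans_le inf_le_left))
    have hj : f j R.rep = 0 := (hfX j _).2 ((rep_mem_iff _ _).2 (hR.trans_le inf_le_right))
    rw [← hyz]
    simp [hfp, hi, hj]

theorem linesMissing_nonempty {A : Arr ℂ} (hfr : FullRank A) (P : Pt ℂ) :
    (linesMissing A P).Nonempty := by
  by_contra h
  rw [Finset.not_nonempty_iff_eq_empty, linesMissing, Finset.filter_eq_empty_iff] at h
  have hle : P.submodule ≤ ⨅ L ∈ A, L := le_iInf₂ fun L hL => not_not.1 (h hL)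
  rw [hfr, le_bot_iff] at hle
  have := P.finrank_submodule
  rw [hle] at this
  simp at this

/-- The Dirac–Motzkin bound `|Sing₂(A)| ≥ n/2` holds for every full rank
complex supersolvable arrangement of `n ≤ 12` lines. -/
theorem dirac_motzkin_complex_small (A : Arr ℂ) (hA : IsLineArr A)
    (hfr : FullRank A) (hss : Supersolvable A) (hn : A.card ≤ 12) :
    A.card ≤ 2 * (Sing2Set A).ncard := by
  obtain ⟨P, hP⟩ := hss
  have hcard : (linesThrough A P).card + (linesMissing A P).card = A.card :=
    Finset.card_filter_add_card_filter_not _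
  have hk := (linesMissing_nonempty hfr P).card_pos
  have hsum := sum_card_simpleLines_le hA P
  rcases le_or_gt (linesMissing A P).card (linesThrough A P).card with h | h
  · obtain ⟨t, ht⟩ := Nat.exists_eq_add_of_le h
    have hle := Finset.card_nsmul_le_sum (linesMissing A P)
      (fun L => (simpleLines A P L).card) (t + 1) fun L hL => by
        have := card_linesThrough_lt hA hL
        omega
    rw [smul_eq_mul] at hle
    nlinarith
  · have hle := Finset.card_nsmul_le_sum (linesMissing A P)
      (fun L => (simpleLines A P L).card) 1 fun L hL =>
        (simpleLines_nonempty hA hP (by omega) hL).card_pos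
    rw [smul_eq_mul, mul_one] at hle
    omega
end
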